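/- arXiv:1707.08109 — 2 statements merged into one kernel-verified Lean document; each statement's English description precedes it below -/
import Mathlib

section
/- A left-c.e. real β in (0,1) is Martin-Löf random if and only if α ≤_S β for every left-c.e. real α in (0,1). -/
open scoped Classical

/-- A set of binary strings is prefix-free if no element is a proper prefix of another. -/
def PrefixFreeSet (D : Set (List Bool)) : Prop :=
  ∀ σ ∈ D, ∀ τ ∈ D, σ <+: τ → σ = τ

/-- A prefix-free machine: a partial computable function on binary strings
whose domain is prefix-free. -/
structure PFMachine where
  f : List Bool →. List Bool
  partrec : Partrec f
  prefixFree : PrefixFreeSet {σ | (f σ).Dom}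

/-- The halting probability `Ω_M = Σ_{σ ∈ dom M} 2^{-|σ|}` of a prefix-free machine. -/
noncomputable def omegaOf (M : PFMachine) : ℝ :=
  ∑' σ : {σ : List Bool // (M.f σ).Dom}, (2 : ℝ) ^ (-(σ.1.length : ℤ))

/-- A computable nondecreasing sequence of rationals converging to `x`. -/
def LeftCEApprox (q : ℕ → ℚ) (x : ℝ) : Prop :=
  Computable q ∧ Monotone q ∧
    Filter.Tendsto (fun n => (q n : ℝ)) Filter.atTop (nhds x)

/-- A real is left-c.e. if some computable nondecreasing rational sequence converges to it. -/
def LeftCE (x : ℝ) : Prop := ∃ q : ℕ → ℚ, LeftCEApprox q x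

/-- A real is right-c.e. if its negative is left-c.e. -/
def RightCE (x : ℝ) : Prop := LeftCE (-x)

/-- Martin-Löf randomness of a real, via computable sequences of open rational intervals. -/
def MLRandom (x : ℝ) : Prop :=
  ∀ I : ℕ → ℕ → ℚ × ℚ, Computable₂ I →
    (∀ n : ℕ, MeasureTheory.volume
        (⋃ k : ℕ, Set.Ioo (((I n k).1 : ℝ)) (((I n k).2 : ℝ))) ≤ 2 ^ (-(n : ℤ))) →
    x ∉ ⋂ n : ℕ, ⋃ k : ℕ, Set.Ioo (((I n k).1 : ℝ)) (((I n k).2 : ℝ))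

/-- A universal prefix-free machine: it simulates every prefix-free machine
via a fixed prefix. -/
def UniversalPF (U : PFMachine) : Prop :=
  ∀ M : PFMachine, ∃ ρ : List Bool, ∀ σ : List Bool, U.f (ρ ++ σ) = M.f σ

/-- The `i`-th binary digit of a real (of its expansion not ending in all 1s). -/
noncomputable def rdigit (x : ℝ) (i : ℕ) : Bool := decide (⌊x * 2 ^ (i + 1)⌋ % 2 = 1)

/-- The first `n` binary digits of a real. -/
noncomputable def bits (x : ℝ) (n : ℕ) : List Bool := (List.range n).map (rdigit x)

/-- Prefix-free Kolmogorov complexity of `σ` with respect to machine `M`,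
with value `⊤` if `σ` is not in the range. -/
noncomputable def Kf (M : PFMachine) (σ : List Bool) : ℕ∞ :=
  ⨅ p : {p : List Bool // σ ∈ M.f p}, (p.1.length : ℕ∞)

/-- An optimal prefix-free machine: minimizes `K` up to additive constants. -/
def OptimalPF (V : PFMachine) : Prop :=
  ∀ M : PFMachine, ∃ c : ℕ, ∀ σ : List Bool, Kf V σ ≤ Kf M σ + c

/-- Solovay reducibility for left-c.e. reals. -/
def SolovayRed (α β : ℝ) : Prop :=
  ∃ c : ℚ, ∃ f : ℚ →. ℚ, Partrec f ∧
    ∀ q : ℚ, (q : ℝ) < β →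
      ∃ r ∈ f q, (r : ℝ) < α ∧ α - (r : ℝ) < (c : ℝ) * (β - (q : ℝ))

/-- `X` is computable from `Y` with oracle-use `h`. -/
def ComputableFromWithUse (X Y : ℝ) (h : ℕ → ℕ) : Prop :=
  ∃ Φ : List Bool →. List Bool, Partrec Φ ∧
    ∀ n : ℕ, Φ (bits Y (h n)) = Part.some (bits X n)

section RationalArithmetic

open Encodable

attribute [local instance] Encodable.decidableRangeEncode in
theorem encode_ofNat_ofEncodableOfInfinite {α : Type*} [e : Encodable α] [Infinite α]
    [Infinite (Set.range (@encode α _))] (n : ℕ) :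
    (encode (@Denumerable.ofNat α (Denumerable.ofEncodableOfInfinite α) n) : ℕ) =
      (Nat.Subtype.ofNat (Set.range (@encode α _)) n : ℕ) := by
  have : (@Denumerable.ofNat α (Denumerable.ofEncodableOfInfinite α) n)
      = (equivRangeEncode α).symm (Nat.Subtype.ofNat (Set.range (@encode α _)) n) := by
    apply Option.some.inj
    rw [← @Denumerable.decode_eq_ofNat α (Denumerable.ofEncodableOfInfinite α)]
    rfl
  rw [this]
  exact congrArg Subtype.val ((equivRangeEncode α).apply_symm_apply _)

attribute [local instance] Encodable.decidableRangeEncode in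
/-- If the range of an encoding is decidable, the encodings of the elements of the derived
denumeration can be computed. -/
theorem computable_encode_ofEncodableOfInfinite {α : Type*} [e : Encodable α] [Infinite α]
    (h : ComputablePred fun n => n ∈ Set.range (@encode α _)) :
    Computable fun n =>
      (encode (@Denumerable.ofNat α (Denumerable.ofEncodableOfInfinite α) n) : ℕ) := by
  have : Infinite (Set.range (@encode α _)) :=
    Infinite.of_injective _ (Equiv.ofInjective _ encode_injective).injective
  have hex : ∀ x : ℕ, ∃ m, x < m ∧ m ∈ Set.range (@encode α _) := fun x => by
    obtain ⟨m, hm, hx⟩ := (Set.infinite_coe_iff.1 this).exists_gt x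
    exact ⟨m, hx, hm⟩
  have hP : ComputablePred fun p : ℕ × ℕ => p.1 < p.2 ∧ p.2 ∈ Set.range (@encode α _) := by
    refine ⟨inferInstance, ?_⟩
    have h1 : Computable fun p : ℕ × ℕ => decide (p.1 < p.2) := Primrec.nat_lt.decide.to_comp
    have h2 : Computable fun p : ℕ × ℕ => decide (p.2 ∈ Set.range (@encode α _)) :=
      h.decide.comp Computable.snd
    exact ((Primrec.and.to_comp.comp h1 h2)).of_eq fun p => by simp
  have hfind := Computable.find hP hex
  have hrec : Computable fun n : ℕ => Nat.rec (motive := fun _ => ℕ)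
      (Nat.Subtype.ofNat (Set.range (@encode α _)) 0 : ℕ) (fun _ x => Nat.find (hex x)) n :=
    Computable.nat_rec Computable.id (Computable.const _)
      (hfind.comp (Computable.snd.comp Computable.snd)).to₂
  refine hrec.of_eq fun n => ?_
  rw [encode_ofNat_ofEncodableOfInfinite]
  induction n with
  | zero => rfl
  | succ n ih =>
    change Nat.find (hex (Nat.rec _ _ n)) = _
    rw [Nat.find_eq_iff]
    rw [ih]
    refine ⟨⟨Nat.Subtype.lt_succ_self _, (Nat.Subtype.succ _).2⟩, ?_⟩
    rintro m hm ⟨h1, h2⟩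
    have : Nat.Subtype.succ (Nat.Subtype.ofNat (Set.range (@encode α _)) n) ≤ ⟨m, h2⟩ :=
      Nat.Subtype.succ_le_of_lt h1
    exact absurd hm (not_lt.2 this)

theorem encode_int_natAbs (z : ℤ) : z.natAbs = (encode z + 1) / 2 := by
  cases z with
  | ofNat n => change n = (2 * n + 1) / 2; omega
  | negSucc n => change n + 1 = (2 * n + 1 + 1) / 2; omega

theorem encode_int_toNat (z : ℤ) :
    z.toNat = if encode z % 2 = 0 then encode z / 2 else 0 := by
  cases z with
  | ofNat n =>
    change n = if (2 * n) % 2 = 0 then (2 * n) / 2 else 0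
    rw [if_pos (by omega)]; omega
  | negSucc n =>
    change 0 = if (2 * n + 1) % 2 = 0 then (2 * n + 1) / 2 else 0
    rw [if_neg (by omega)]

theorem encode_int_neg_toNat (z : ℤ) :
    (-z).toNat = if encode z % 2 = 0 then 0 else (encode z + 1) / 2 := by
  cases z with
  | ofNat n =>
    change (-(n : ℤ)).toNat = if (2 * n) % 2 = 0 then 0 else (2 * n + 1) / 2
    rw [if_pos (by omega)]; omega
  | negSucc n =>
    change n + 1 = if (2 * n + 1) % 2 = 0 then 0 else (2 * n + 1 + 1) / 2
    rw [if_neg (by omega)]; omega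

theorem encode_rat_eq (q : ℚ) :
    @encode ℚ Rat.instEncodable q = Nat.pair (encode q.num) q.den := rfl

theorem coprime_iff_forall_lt (a b : ℕ) (hb : 0 < b) :
    a.Coprime b ↔ ∀ d < b + 1, ¬ (1 < d ∧ a % d = 0 ∧ b % d = 0) := by
  constructor
  · rintro h d - ⟨h1, h2, h3⟩
    exact h1.ne' (Nat.eq_one_of_dvd_coprimes h (Nat.dvd_of_mod_eq_zero h2)
      (Nat.dvd_of_mod_eq_zero h3))
  · intro h
    by_contra hc
    have hg : 0 < a.gcd b := Nat.gcd_pos_of_pos_right _ hb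
    refine h (a.gcd b) (Nat.lt_succ_of_le (Nat.gcd_le_right _ hb)) ⟨?_, ?_, ?_⟩
    · have : a.gcd b ≠ 1 := hc
      omega
    · exact Nat.mod_eq_zero_of_dvd (Nat.gcd_dvd_left _ _)
    · exact Nat.mod_eq_zero_of_dvd (Nat.gcd_dvd_right _ _)

theorem mem_range_encode_rat (n : ℕ) :
    n ∈ Set.range (@encode ℚ Rat.instEncodable) ↔
      0 < n.unpair.2 ∧ ∀ d < n.unpair.2 + 1,
        ¬ (1 < d ∧ ((n.unpair.1 + 1) / 2) % d = 0 ∧ n.unpair.2 % d = 0) := by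
  constructor
  · rintro ⟨q, rfl⟩
    rw [encode_rat_eq]
    simp only [Nat.unpair_pair]
    refine ⟨q.den_pos, ?_⟩
    rw [← coprime_iff_forall_lt _ _ q.den_pos, ← encode_int_natAbs]
    exact q.reduced
  · rintro ⟨h0, h1⟩
    rw [← coprime_iff_forall_lt _ _ h0] at h1
    refine ⟨⟨Denumerable.ofNat ℤ n.unpair.1, n.unpair.2, h0.ne', ?_⟩, ?_⟩
    · rw [encode_int_natAbs, Denumerable.encode_ofNat]
      exact h1
    · rw [encode_rat_eq]
      change Nat.pair (encode (Denumerable.ofNat ℤ n.unpair.1)) n.unpair.2 = n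
      rw [Denumerable.encode_ofNat, Nat.pair_unpair]

theorem computablePred_mem_range_encode_rat :
    ComputablePred fun n => n ∈ Set.range (@encode ℚ Rat.instEncodable) := by
  refine ComputablePred.of_eq ?_ fun n => (mem_range_encode_rat n).symm
  apply PrimrecPred.computablePred
  have h1 : Primrec fun n : ℕ => n.unpair.1 := Primrec.fst.comp Primrec.unpair
  have h2 : Primrec fun n : ℕ => n.unpair.2 := Primrec.snd.comp Primrec.unpair
  refine PrimrecPred.and (Primrec.nat_lt.comp (Primrec.const 0) h2) ?_
  have hR : PrimrecRel fun d n : ℕ =>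
      ¬ (1 < d ∧ ((n.unpair.1 + 1) / 2) % d = 0 ∧ n.unpair.2 % d = 0) := by
    apply PrimrecPred.not
    refine PrimrecPred.and (Primrec.nat_lt.comp (Primrec.const 1) Primrec.fst)
      (PrimrecPred.and (Primrec.eq.comp (Primrec.nat_mod.comp ?_ Primrec.fst) (Primrec.const 0))
        (Primrec.eq.comp (Primrec.nat_mod.comp (h2.comp Primrec.snd) Primrec.fst)
          (Primrec.const 0)))
    exact Primrec.nat_div.comp (Primrec.succ.comp (h1.comp Primrec.snd)) (Primrec.const 2)
  exact hR.forall_lt.comp (Primrec.succ.comp h2) Primrec.id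

theorem computable_encode_rat : Computable fun q : ℚ => @encode ℚ Rat.instEncodable q :=
  ((computable_encode_ofEncodableOfInfinite computablePred_mem_range_encode_rat).comp
    (Computable.encode (α := ℚ))).of_eq fun q => by
      congr 1
      exact Denumerable.ofNat_encode q

theorem computable_rat_den : Computable fun q : ℚ => q.den :=
  (((Primrec.snd.comp Primrec.unpair).to_comp).comp computable_encode_rat).of_eq fun q => by
    simp [encode_rat_eq]

theorem computable_encode_num : Computable fun q : ℚ => encode q.num :=
  (((Primrec.fst.comp Primrec.unpair).to_comp).comp computable_encode_rat).of_eq fun q => by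
    simp [encode_rat_eq]

theorem primrec_mod_two : PrimrecPred fun m : ℕ => m % 2 = 0 :=
  Primrec.eq.comp (Primrec.nat_mod.comp Primrec.id (Primrec.const 2)) (Primrec.const 0)

theorem computable_rat_num_toNat : Computable fun q : ℚ => q.num.toNat :=
  ((Primrec.ite primrec_mod_two (Primrec.nat_div.comp Primrec.id (Primrec.const 2))
    (Primrec.const 0)).to_comp.comp computable_encode_num).of_eq fun q =>
      (encode_int_toNat q.num).symm

theorem computable_rat_num_neg_toNat : Computable fun q : ℚ => (-q.num).toNat :=
  ((Primrec.ite primrec_mod_two (Primrec.const 0)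
    (Primrec.nat_div.comp Primrec.succ (Primrec.const 2))).to_comp.comp
      computable_encode_num).of_eq fun q => (encode_int_neg_toNat q.num).symm

theorem rat_eq_toNat_sub_div (q : ℚ) :
    q = ((q.num.toNat : ℚ) - ((-q.num).toNat : ℚ)) / q.den := by
  have h : ((q.num.toNat : ℤ) - ((-q.num).toNat : ℤ)) = q.num := by omega
  have h' : ((q.num.toNat : ℚ) - ((-q.num).toNat : ℚ)) = (q.num : ℚ) := by exact_mod_cast h
  rw [h', Rat.num_div_den]

theorem nat_sub_div_eq_iff {x y d x' y' d' : ℕ} (hd : 0 < d) (hd' : 0 < d') :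
    ((x : ℚ) - y) / d = ((x' : ℚ) - y') / d' ↔ x * d' + y' * d = x' * d + y * d' := by
  have h1 : (d : ℚ) ≠ 0 := by positivity
  have h2 : (d' : ℚ) ≠ 0 := by positivity
  rw [div_eq_div_iff h1 h2, ← @Nat.cast_inj ℚ]
  push_cast
  constructor <;> intro h <;> linarith

theorem nat_sub_div_le_iff {x y d x' y' d' : ℕ} (hd : 0 < d) (hd' : 0 < d') :
    ((x : ℚ) - y) / d ≤ ((x' : ℚ) - y') / d' ↔ x * d' + y' * d ≤ x' * d + y * d' := by
  have h1 : (0 : ℚ) < d := by positivity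
  have h2 : (0 : ℚ) < d' := by positivity
  rw [div_le_div_iff₀ h1 h2, ← @Nat.cast_le ℚ]
  push_cast
  constructor <;> intro h <;> linarith

variable {α : Type*} [Primcodable α]

theorem Computable.nat_add' {f g : α → ℕ} (hf : Computable f) (hg : Computable g) :
    Computable fun a => f a + g a := Primrec.nat_add.to_comp.comp hf hg

theorem Computable.nat_mul' {f g : α → ℕ} (hf : Computable f) (hg : Computable g) :
    Computable fun a => f a * g a := Primrec.nat_mul.to_comp.comp hf hg

/-- A rational function given by computable natural numerators and denominator is computable. -/
theorem Computable.rat_of_nat_sub_div {f : α → ℚ} {x y d : α → ℕ} (hx : Computable x)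
    (hy : Computable y) (hd : Computable d) (hpos : ∀ a, 0 < d a)
    (hf : ∀ a, f a = ((x a : ℚ) - y a) / d a) : Computable f := by
  let P : α → ℕ → Prop := fun a n =>
    x a * (Denumerable.ofNat ℚ n).den + (-(Denumerable.ofNat ℚ n).num).toNat * d a
      = (Denumerable.ofNat ℚ n).num.toNat * d a + y a * (Denumerable.ofNat ℚ n).den
  have hiff : ∀ a n, P a n ↔ f a = Denumerable.ofNat ℚ n := by
    intro a n
    rw [hf a]
    conv_rhs => rw [rat_eq_toNat_sub_div (Denumerable.ofNat ℚ n)]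
    rw [nat_sub_div_eq_iff (hpos a) (Rat.den_pos _)]
  have hex : ∀ a, ∃ n, P a n := fun a => ⟨@encode ℚ Rat.instDenumerable.toEncodable (f a), by
    rw [hiff, Denumerable.ofNat_encode]⟩
  have hP : ComputablePred fun p : α × ℕ => P p.1 p.2 := by
    refine ⟨fun p => inferInstanceAs (Decidable (_ = _)), ?_⟩
    have hq : Computable fun p : α × ℕ => Denumerable.ofNat ℚ p.2 :=
      (Computable.ofNat ℚ).comp Computable.snd
    have hl := Computable.nat_add'
      (Computable.nat_mul' (hx.comp Computable.fst) (computable_rat_den.comp hq))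
      (Computable.nat_mul' (computable_rat_num_neg_toNat.comp hq) (hd.comp Computable.fst))
    have hr := Computable.nat_add'
      (Computable.nat_mul' (computable_rat_num_toNat.comp hq) (hd.comp Computable.fst))
      (Computable.nat_mul' (hy.comp Computable.fst) (computable_rat_den.comp hq))
    exact (Primrec.eq.decide.to_comp.comp hl hr).of_eq fun p => by simp [P]
  refine ((Computable.ofNat ℚ).comp (Computable.find hP hex)).of_eq fun a => ?_
  exact ((hiff a _).1 (Nat.find_spec (hex a))).symm

theorem Computable.rat_neg {f : α → ℚ} (hf : Computable f) : Computable fun a => -f a :=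
  Computable.rat_of_nat_sub_div (computable_rat_num_neg_toNat.comp hf)
    (computable_rat_num_toNat.comp hf) (computable_rat_den.comp hf) (fun a => (f a).den_pos)
    fun a => by
      conv_lhs => rw [rat_eq_toNat_sub_div (f a)]
      ring

theorem Computable.rat_add {f g : α → ℚ} (hf : Computable f) (hg : Computable g) :
    Computable fun a => f a + g a := by
  refine Computable.rat_of_nat_sub_div
    (x := fun a => (f a).num.toNat * (g a).den + (g a).num.toNat * (f a).den)
    (y := fun a => (-(f a).num).toNat * (g a).den + (-(g a).num).toNat * (f a).den)
    (d := fun a => (f a).den * (g a).den)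
    ?_ ?_ ?_ (fun a => Nat.mul_pos (Rat.den_pos _) (Rat.den_pos _)) fun a => ?_
  · exact Computable.nat_add'
      (Computable.nat_mul' (computable_rat_num_toNat.comp hf) (computable_rat_den.comp hg))
      (Computable.nat_mul' (computable_rat_num_toNat.comp hg) (computable_rat_den.comp hf))
  · exact Computable.nat_add'
      (Computable.nat_mul' (computable_rat_num_neg_toNat.comp hf) (computable_rat_den.comp hg))
      (Computable.nat_mul' (computable_rat_num_neg_toNat.comp hg) (computable_rat_den.comp hf))
  · exact Computable.nat_mul' (computable_rat_den.comp hf) (computable_rat_den.comp hg)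
  · conv_lhs => rw [rat_eq_toNat_sub_div (f a), rat_eq_toNat_sub_div (g a)]
    have h1 : ((f a).den : ℚ) ≠ 0 := by exact_mod_cast (f a).den_nz
    have h2 : ((g a).den : ℚ) ≠ 0 := by exact_mod_cast (g a).den_nz
    push_cast
    field_simp
    ring

theorem Computable.rat_sub {f g : α → ℚ} (hf : Computable f) (hg : Computable g) :
    Computable fun a => f a - g a :=
  (hf.rat_add hg.rat_neg).of_eq fun _ => (sub_eq_add_neg _ _).symm

theorem Computable.rat_mul {f g : α → ℚ} (hf : Computable f) (hg : Computable g) :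
    Computable fun a => f a * g a := by
  refine Computable.rat_of_nat_sub_div
    (x := fun a => (f a).num.toNat * (g a).num.toNat + (-(f a).num).toNat * (-(g a).num).toNat)
    (y := fun a => (f a).num.toNat * (-(g a).num).toNat + (-(f a).num).toNat * (g a).num.toNat)
    (d := fun a => (f a).den * (g a).den)
    ?_ ?_ ?_ (fun a => Nat.mul_pos (Rat.den_pos _) (Rat.den_pos _)) fun a => ?_
  · exact Computable.nat_add'
      (Computable.nat_mul' (computable_rat_num_toNat.comp hf) (computable_rat_num_toNat.comp hg))
      (Computable.nat_mul' (computable_rat_num_neg_toNat.comp hf)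
        (computable_rat_num_neg_toNat.comp hg))
  · exact Computable.nat_add'
      (Computable.nat_mul' (computable_rat_num_toNat.comp hf)
        (computable_rat_num_neg_toNat.comp hg))
      (Computable.nat_mul' (computable_rat_num_neg_toNat.comp hf)
        (computable_rat_num_toNat.comp hg))
  · exact Computable.nat_mul' (computable_rat_den.comp hf) (computable_rat_den.comp hg)
  · conv_lhs => rw [rat_eq_toNat_sub_div (f a), rat_eq_toNat_sub_div (g a)]
    have h1 : ((f a).den : ℚ) ≠ 0 := by exact_mod_cast (f a).den_nz
    have h2 : ((g a).den : ℚ) ≠ 0 := by exact_mod_cast (g a).den_nz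
    push_cast
    field_simp
    ring

theorem Computable.rat_le {f g : α → ℚ} (hf : Computable f) (hg : Computable g) :
    Computable fun a => decide (f a ≤ g a) := by
  have hl := Computable.nat_add'
    (Computable.nat_mul' (computable_rat_num_toNat.comp hf) (computable_rat_den.comp hg))
    (Computable.nat_mul' (computable_rat_num_neg_toNat.comp hg) (computable_rat_den.comp hf))
  have hr := Computable.nat_add'
    (Computable.nat_mul' (computable_rat_num_toNat.comp hg) (computable_rat_den.comp hf))
    (Computable.nat_mul' (computable_rat_num_neg_toNat.comp hf) (computable_rat_den.comp hg))
  refine (Primrec.nat_le.decide.to_comp.comp hl hr).of_eq fun a => ?_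
  apply decide_eq_decide.2
  rw [← nat_sub_div_le_iff (Rat.den_pos _) (Rat.den_pos _), ← rat_eq_toNat_sub_div,
    ← rat_eq_toNat_sub_div]

theorem Computable.rat_lt {f g : α → ℚ} (hf : Computable f) (hg : Computable g) :
    Computable fun a => decide (f a < g a) :=
  (Primrec.not.to_comp.comp (hg.rat_le hf)).of_eq fun a => by
    by_cases h : g a ≤ f a <;> simp [h, lt_iff_not_ge]

theorem Computable.ite {σ : Type*} [Primcodable σ] {c : α → Prop} [DecidablePred c]
    {f g : α → σ} (hc : Computable fun a => decide (c a)) (hf : Computable f)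
    (hg : Computable g) : Computable fun a => if c a then f a else g a :=
  (Computable.cond hc hf hg).of_eq fun a => by by_cases h : c a <;> simp [h]

theorem Computable.rat_max {f g : α → ℚ} (hf : Computable f) (hg : Computable g) :
    Computable fun a => max (f a) (g a) :=
  ((hf.rat_le hg).ite hg hf).of_eq fun _ => (max_def _ _).symm

theorem Computable.rat_min {f g : α → ℚ} (hf : Computable f) (hg : Computable g) :
    Computable fun a => min (f a) (g a) :=
  ((hf.rat_le hg).ite hf hg).of_eq fun _ => (min_def _ _).symm

theorem Computable.rat_pow (r : ℚ) {k : α → ℕ} (hk : Computable k) :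
    Computable fun a => r ^ k a :=
  (Computable.nat_rec (σ := ℚ) (h := fun _ p => p.2 * r) hk (Computable.const 1)
    ((Computable.snd.comp Computable.snd).rat_mul (Computable.const r)).to₂).of_eq fun a => by
      induction k a with
      | zero => simp
      | succ n ih => rw [pow_succ, ← ih]

end RationalArithmetic

section SolovayTest

open Filter MeasureTheory
open scoped Topology ENNReal

theorem two_zpow_neg_eq_ofReal (n : ℕ) :
    (2 : ℝ≥0∞) ^ (-(n : ℤ)) = ENNReal.ofReal ((1 / 2) ^ n) := by
  rw [ENNReal.ofReal_pow (by norm_num), ENNReal.zpow_neg, zpow_natCast, ENNReal.inv_pow]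
  congr 1
  rw [one_div, ENNReal.ofReal_inv_of_pos two_pos]
  norm_num

/-- A left-c.e. real has an approximation lying strictly below it. -/
theorem LeftCE.exists_strict_approx {x : ℝ} (h : LeftCE x) :
    ∃ q : ℕ → ℚ, LeftCEApprox q x ∧ ∀ n, (q n : ℝ) < x := by
  obtain ⟨q, hc, hm, ht⟩ := h
  have hpow : Tendsto (fun n : ℕ => ((1 / 2 : ℝ)) ^ n) atTop (𝓝 0) :=
    tendsto_pow_atTop_nhds_zero_of_lt_one (by norm_num) (by norm_num)
  refine ⟨fun n => q n - (1 / 2) ^ n, ⟨hc.rat_sub (Computable.rat_pow _ Computable.id),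
    fun m n hmn => ?_, ?_⟩, fun n => ?_⟩
  · have := hm hmn
    have h2 : (1 / 2 : ℚ) ^ n ≤ (1 / 2) ^ m :=
      pow_le_pow_of_le_one (by norm_num) (by norm_num) hmn
    simp only
    linarith
  · have := ht.sub hpow
    rw [sub_zero] at this
    refine this.congr fun n => ?_
    push_cast
    rfl
  · have h1 : (q n : ℝ) ≤ x :=
      Monotone.ge_of_tendsto (f := fun n => (q n : ℝ)) (Rat.cast_mono.comp hm) ht n
    have h2 : (0 : ℝ) < (1 / 2) ^ n := by positivity
    push_cast
    linarith

/-- The state `(R, A)` of Solovay's test: whenever the approximation `b` catches up with `R`,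
the increase of `a` since the last update, scaled by `δ`, is requested on top of `b`. -/
def solovayState (a b : ℕ → ℚ) (δ : ℚ) : ℕ → ℚ × ℚ
  | 0 => (b 0, a 0)
  | s + 1 =>
    if (solovayState a b δ s).1 ≤ b s then
      (b s + δ * (a s - (solovayState a b δ s).2), a s)
    else solovayState a b δ s

theorem computable_solovayState {γ : Type*} [Primcodable γ] {a b : ℕ → ℚ} {δ : γ → ℚ} {k : γ → ℕ}
    (ha : Computable a) (hb : Computable b) (hδ : Computable δ) (hk : Computable k) :
    Computable fun c => solovayState a b (δ c) (k c) := by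
  have hs : Computable fun p : γ × (ℕ × (ℚ × ℚ)) => p.2.1 :=
    Computable.fst.comp Computable.snd
  have hst : Computable fun p : γ × (ℕ × (ℚ × ℚ)) => p.2.2 :=
    Computable.snd.comp Computable.snd
  have hd : Computable fun p : γ × (ℕ × (ℚ × ℚ)) => δ p.1 := hδ.comp Computable.fst
  have hstep : Computable₂ fun (c : γ) (r : ℕ × (ℚ × ℚ)) =>
      if r.2.1 ≤ b r.1 then (b r.1 + δ c * (a r.1 - r.2.2), a r.1) else r.2 :=
    Computable.ite ((Computable.fst.comp hst).rat_le (hb.comp hs))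
      (((hb.comp hs).rat_add (hd.rat_mul ((ha.comp hs).rat_sub
        (Computable.snd.comp hst)))).pair (ha.comp hs)) hst
  refine (Computable.nat_rec hk (Computable.const (b 0, a 0)) hstep).of_eq fun c => ?_
  induction k c with
  | zero => rfl
  | succ s ih =>
    simp only at ih ⊢
    rw [solovayState, ih]

variable {a b : ℕ → ℚ} {δ : ℚ}

theorem solovayState_snd_le (ha : Monotone a) (s : ℕ) : (solovayState a b δ s).2 ≤ a s := by
  induction s with
  | zero => exact le_rfl
  | succ s ih =>
    rw [solovayState]
    split_ifs
    · exact ha s.le_succ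
    · exact ih.trans (ha s.le_succ)

theorem solovayState_snd_mono (ha : Monotone a) :
    Monotone fun s => (solovayState a b δ s).2 := by
  refine monotone_nat_of_le_succ fun s => ?_
  rw [solovayState]
  split_ifs
  · exact solovayState_snd_le ha s
  · exact le_rfl

theorem solovayState_sub_mono :
    Monotone fun s => (solovayState a b δ s).1 - δ * (solovayState a b δ s).2 := by
  refine monotone_nat_of_le_succ fun s => ?_
  rw [solovayState]
  split_ifs with h
  · simp only
    linarith
  · exact le_rfl

/-- The `s`-th interval of Solovay's test. -/
def solovayInterval (a b : ℕ → ℚ) (δ : ℚ) (s : ℕ) : ℚ × ℚ :=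
  (b s, b s + 2 * δ * ((solovayState a b δ (s + 1)).2 - (solovayState a b δ s).2))

theorem computable_solovayInterval {δ : ℕ → ℚ} (ha : Computable a) (hb : Computable b)
    (hδ : Computable δ) :
    Computable₂ fun n s => solovayInterval a b (δ n) s := by
  have hδ' : Computable fun p : ℕ × ℕ => δ p.1 := hδ.comp Computable.fst
  have hb' : Computable fun p : ℕ × ℕ => b p.2 := hb.comp Computable.snd
  have h := Computable.snd.comp (computable_solovayState ha hb hδ' Computable.snd)
  have h' := Computable.snd.comp
    (computable_solovayState ha hb hδ' (Computable.succ.comp Computable.snd))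
  exact hb'.pair (hb'.rat_add (((Computable.const 2).rat_mul hδ').rat_mul (h'.rat_sub h)))

theorem volume_iUnion_solovayInterval_le {α : ℝ} (ha : Monotone a) (hα : ∀ s, (a s : ℝ) < α)
    (hδ : 0 ≤ δ) :
    volume (⋃ s, Set.Ioo ((solovayInterval a b δ s).1 : ℝ) ((solovayInterval a b δ s).2 : ℝ)) ≤
      ENNReal.ofReal (2 * δ * (α - a 0)) := by
  have hδ' : (0 : ℝ) ≤ δ := by exact_mod_cast hδ
  refine (measure_iUnion_le _).trans (ENNReal.tsum_le_of_sum_range_le fun N => ?_)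
  have : ∀ s, volume (Set.Ioo ((solovayInterval a b δ s).1 : ℝ) ((solovayInterval a b δ s).2 : ℝ)) =
      ENNReal.ofReal (2 * δ * ((solovayState a b δ (s + 1)).2 - (solovayState a b δ s).2)) := by
    intro s
    rw [Real.volume_Ioo]
    simp [solovayInterval]
  rw [Finset.sum_congr rfl fun s _ => this s, ← ENNReal.ofReal_sum_of_nonneg]
  · refine ENNReal.ofReal_le_ofReal ?_
    rw [← Finset.mul_sum, Finset.sum_range_sub fun s => ((solovayState a b δ s).2 : ℝ)]
    have h1 : ((solovayState a b δ N).2 : ℝ) ≤ a N := by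
      exact_mod_cast solovayState_snd_le ha N
    have h2 := hα N
    have h3 : (solovayState a b δ 0).2 = a 0 := rfl
    rw [h3]
    gcongr
    linarith
  · intro s _
    have : ((solovayState a b δ s).2 : ℝ) ≤ (solovayState a b δ (s + 1)).2 := by
      exact_mod_cast solovayState_snd_mono ha s.le_succ
    have := sub_nonneg.2 this
    positivity

theorem solovayState_fst_lt {β : ℝ} (ha : Monotone a) (hb : ∀ s, (b s : ℝ) < β) (hδ : 0 < δ)
    (hβ : β ∉ ⋃ s, Set.Ioo ((solovayInterval a b δ s).1 : ℝ) ((solovayInterval a b δ s).2 : ℝ))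
    (s : ℕ) : ((solovayState a b δ s).1 : ℝ) < β := by
  induction s with
  | zero => exact hb 0
  | succ s ih =>
    by_cases h : (solovayState a b δ s).1 ≤ b s
    · have hs : solovayState a b δ (s + 1) =
        (b s + δ * (a s - (solovayState a b δ s).2), a s) := by rw [solovayState, if_pos h]
      have h1 : ¬ β < b s + 2 * δ * (a s - (solovayState a b δ s).2) := fun hlt =>
        hβ (Set.mem_iUnion.2 ⟨s, by simpa [solovayInterval] using hb s, by
          simpa [solovayInterval, hs] using hlt⟩)
      rw [hs]
      push_cast
      have h2 := hb s
      have h3 : (0 : ℝ) < δ := by exact_mod_cast hδ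
      have h4 : ((solovayState a b δ s).2 : ℝ) ≤ a s := by
        exact_mod_cast solovayState_snd_le ha s
      nlinarith
    · rwa [solovayState, if_neg h]

/-- If `R` stays below the limit of `b` and changes only at stages where `b` has caught up with
it, then `b` catches up with `R` at arbitrarily late stages. -/
theorem exists_ge_le_of_tendsto {b R : ℕ → ℚ} {β : ℝ}
    (hb : Tendsto (fun s => (b s : ℝ)) atTop (𝓝 β)) (hR : ∀ s, (R s : ℝ) < β)
    (hstep : ∀ s, b s < R s → R (s + 1) = R s) (s : ℕ) : ∃ u, s ≤ u ∧ R u ≤ b u := by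
  by_contra! hno
  have hconst : ∀ u, s ≤ u → R u = R s := by
    intro u hu
    induction u, hu using Nat.le_induction with
    | base => rfl
    | succ u hu ih => rw [hstep u (hno u hu), ih]
  obtain ⟨u, h1, hu⟩ :=
    ((hb.eventually (lt_mem_nhds (hR s))).and (eventually_ge_atTop s)).exists
  have h2 := hno u hu
  rw [hconst u hu] at h2
  exact absurd h1 (not_lt.2 (by exact_mod_cast h2.le))

/-- Searching for the first stage at which `R` exceeds the input, and returning `A` there. -/
def searchAbove (R A : ℕ → ℚ) : ℚ →. ℚ := fun q =>
  (Nat.rfind fun u => Part.some (decide (q < R u))).map A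

theorem partrec_searchAbove {R A : ℕ → ℚ} (hR : Computable R) (hA : Computable A) :
    Partrec (searchAbove R A) := by
  have h : Partrec₂ fun (q : ℚ) (u : ℕ) => (Part.some (decide (q < R u)) : Part Bool) :=
    (Computable.rat_lt Computable.fst (hR.comp Computable.snd)).partrec
  exact Partrec.map (Partrec.rfind h) (hA.comp Computable.snd).to₂

theorem exists_mem_searchAbove {R A : ℕ → ℚ} {q : ℚ} (h : ∃ u, q < R u) :
    ∃ u, q < R u ∧ A u ∈ searchAbove R A q := by
  refine ⟨Nat.find h, Nat.find_spec h, (Part.mem_map_iff _).2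
    ⟨Nat.find h, Nat.mem_rfind.2 ⟨?_, fun {m} hm => ?_⟩, rfl⟩⟩
  · simpa using Nat.find_spec h
  · simpa using Nat.find_min h hm

theorem solovayRed_of_notMem_solovayInterval {α β : ℝ} (hac : Computable a) (ham : Monotone a)
    (hat : Tendsto (fun n => (a n : ℝ)) atTop (𝓝 α)) (haα : ∀ n, (a n : ℝ) < α)
    (hbc : Computable b) (hbm : Monotone b) (hbt : Tendsto (fun n => (b n : ℝ)) atTop (𝓝 β))
    (hbβ : ∀ n, (b n : ℝ) < β) (hδ : 0 < δ)
    (hn : β ∉ ⋃ s, Set.Ioo ((solovayInterval a b δ s).1 : ℝ)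
      ((solovayInterval a b δ s).2 : ℝ)) :
    SolovayRed α β := by
  have hδ' : (0 : ℝ) < δ := by exact_mod_cast hδ
  have hR := solovayState_fst_lt ham hbβ hδ hn
  have hupd := exists_ge_le_of_tendsto (R := fun s => (solovayState a b δ s).1) hbt hR
    fun s hs => by rw [solovayState, if_neg (not_le.2 hs)]
  have hgap : ∀ u, δ * (α - (solovayState a b δ u).2) ≤ β - (solovayState a b δ u).1 := by
    intro u
    refine le_of_tendsto ((hat.sub_const _).const_mul _) (eventually_atTop.2 ⟨u, fun s hs => ?_⟩)
    obtain ⟨v, hv, hv'⟩ := hupd s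
    have h1 : ((solovayState a b δ (v + 1)).2 : ℝ) = a v := by rw [solovayState, if_pos hv']
    have h2 : ((solovayState a b δ u).1 : ℝ) - δ * (solovayState a b δ u).2 ≤
        (solovayState a b δ (v + 1)).1 - δ * (solovayState a b δ (v + 1)).2 := by
      exact_mod_cast solovayState_sub_mono (a := a) (b := b) (δ := δ) (show u ≤ v + 1 by omega)
    have h3 : (a s : ℝ) ≤ a v := by exact_mod_cast ham hv
    have h4 := hR (v + 1)
    rw [h1] at h2
    nlinarith
  have hex : ∀ q : ℚ, (q : ℝ) < β → ∃ u, q < (solovayState a b δ u).1 := by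
    intro q hq
    obtain ⟨s, hs⟩ := (hbt.eventually (lt_mem_nhds hq)).exists
    obtain ⟨v, hv, hv'⟩ := hupd s
    refine ⟨v + 1, ?_⟩
    have h1 : q < b s := by exact_mod_cast hs
    have h2 : (solovayState a b δ v).2 ≤ a v := solovayState_snd_le ham v
    have h3 := hbm hv
    rw [solovayState, if_pos hv']
    have := mul_nonneg hδ.le (sub_nonneg.2 h2)
    simp only
    linarith
  have hstate : Computable fun s => solovayState a b δ s :=
    computable_solovayState hac hbc (Computable.const δ) Computable.id
  refine ⟨δ⁻¹, searchAbove (fun s => (solovayState a b δ s).1) fun s => (solovayState a b δ s).2,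
    partrec_searchAbove (Computable.fst.comp hstate) (Computable.snd.comp hstate), fun q hq => ?_⟩
  obtain ⟨u, hu, hmem⟩ := exists_mem_searchAbove (R := fun s => (solovayState a b δ s).1)
    (A := fun s => (solovayState a b δ s).2) (hex q hq)
  refine ⟨_, hmem, ?_, ?_⟩
  · exact lt_of_le_of_lt (by exact_mod_cast solovayState_snd_le ham u) (haα u)
  · have h1 := hgap u
    have h2 : (q : ℝ) < (solovayState a b δ u).1 := by exact_mod_cast hu
    push_cast
    rw [inv_mul_eq_div, lt_div_iff₀ hδ']
    linarith

theorem MLRandom.solovayRed {α β : ℝ} (h : MLRandom β) (hα : LeftCE α) (hβ : LeftCE β) :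
    SolovayRed α β := by
  obtain ⟨a, ⟨hac, ham, hat⟩, haα⟩ := hα.exists_strict_approx
  obtain ⟨b, ⟨hbc, hbm, hbt⟩, hbβ⟩ := hβ.exists_strict_approx
  obtain ⟨k, hk⟩ := pow_unbounded_of_one_lt (2 * (α - a 0)) (one_lt_two (α := ℝ))
  obtain ⟨n, hn⟩ : ∃ n, β ∉ ⋃ s, Set.Ioo ((solovayInterval a b ((1 / 2) ^ (n + k)) s).1 : ℝ)
      ((solovayInterval a b ((1 / 2) ^ (n + k)) s).2 : ℝ) := by
    have := h (fun n s => solovayInterval a b ((1 / 2) ^ (n + k)) s)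
      (computable_solovayInterval hac hbc (Computable.rat_pow _
        (Computable.nat_add' Computable.id (Computable.const k)))) fun n => by
          refine (volume_iUnion_solovayInterval_le ham haα (by positivity)).trans ?_
          rw [two_zpow_neg_eq_ofReal]
          refine ENNReal.ofReal_le_ofReal ?_
          push_cast
          have h1 : (1 / 2 : ℝ) ^ k * 2 ^ k = 1 := by rw [← mul_pow]; norm_num
          have h2 : (0 : ℝ) < (1 / 2) ^ n := by positivity
          have h3 : (0 : ℝ) < (1 / 2) ^ k := by positivity
          rw [pow_add]
          nlinarith [mul_pos h2 h3]
    simpa only [Set.mem_iInter, not_forall] using this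
  exact solovayRed_of_notMem_solovayInterval hac ham hat haα hbc hbm hbt hbβ (by positivity) hn

end SolovayTest

section GreedyCover

open Filter MeasureTheory
open scoped Topology ENNReal

/-- The largest right endpoint of an interval among `J 0, …, J (k - 1)` containing `x`, or `x`
itself if there is no such interval. -/
def coverReach (J : ℕ → ℚ × ℚ) (x : ℚ) : ℕ → ℚ
  | 0 => x
  | k + 1 => if (J k).1 < x then max (coverReach J x k) (J k).2 else coverReach J x k

theorem computable_coverReach {γ : Type*} [Primcodable γ] {J : γ → ℕ → ℚ × ℚ} {x : γ → ℚ}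
    {k : γ → ℕ} (hJ : Computable₂ J) (hx : Computable x) (hk : Computable k) :
    Computable fun c => coverReach (J c) (x c) (k c) := by
  have hJ' : Computable fun p : γ × (ℕ × ℚ) => J p.1 p.2.1 :=
    hJ.comp Computable.fst (Computable.fst.comp Computable.snd)
  have hq : Computable fun p : γ × (ℕ × ℚ) => p.2.2 := Computable.snd.comp Computable.snd
  have hx' : Computable fun p : γ × (ℕ × ℚ) => x p.1 := hx.comp Computable.fst
  have hstep : Computable₂ fun (c : γ) (r : ℕ × ℚ) =>
      if (J c r.1).1 < x c then max r.2 (J c r.1).2 else r.2 :=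
    Computable.ite ((Computable.fst.comp hJ').rat_lt hx')
      (hq.rat_max (Computable.snd.comp hJ')) hq
  refine (Computable.nat_rec hk hx hstep).of_eq fun c => ?_
  induction k c with
  | zero => rfl
  | succ s ih =>
    simp only at ih ⊢
    rw [coverReach, ih]

variable {J : ℕ → ℚ × ℚ} {x : ℚ} {b : ℕ → ℚ}

theorem le_coverReach (k : ℕ) : x ≤ coverReach J x k := by
  induction k with
  | zero => exact le_rfl
  | succ k ih =>
    rw [coverReach]
    split_ifs
    · exact le_max_of_le_left ih
    · exact ih

theorem le_coverReach_of_lt {i k : ℕ} (hi : i < k) (hx : (J i).1 < x) :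
    (J i).2 ≤ coverReach J x k := by
  induction k, hi using Nat.le_induction with
  | base => rw [coverReach, if_pos hx]; exact le_max_right _ _
  | succ k hk ih =>
    rw [coverReach]
    split_ifs
    · exact le_max_of_le_left ih
    · exact ih

theorem Ico_coverReach_subset (k : ℕ) :
    Set.Ico (x : ℝ) (coverReach J x k) ⊆ ⋃ i, Set.Ioo ((J i).1 : ℝ) ((J i).2 : ℝ) := by
  induction k with
  | zero => simp [coverReach]
  | succ k ih =>
    rw [coverReach]
    split_ifs with h
    · intro y hy
      by_cases hy' : y < coverReach J x k
      · exact ih ⟨hy.1, hy'⟩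
      · have h1 : y < ((J k).2 : ℝ) := by
          have := hy.2
          push_cast at this
          exact (lt_max_iff.1 this).resolve_left hy'
        exact Set.mem_iUnion.2 ⟨k, lt_of_lt_of_le (by exact_mod_cast h) hy.1, h1⟩
    · exact ih

/-- The state `(R, T)` of the greedy covering: whenever `b` catches up with `R`, the mark `R` is
moved as far as the intervals of `J` allow, and `T` is increased by the length gained. -/
def greedyState (J : ℕ → ℚ × ℚ) (b : ℕ → ℚ) : ℕ → ℚ × ℚ
  | 0 => (b 0, 0)
  | m + 1 =>
    if (greedyState J b m).1 ≤ b m then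
      (coverReach J (b m) m, (greedyState J b m).2 + (coverReach J (b m) m - b m))
    else greedyState J b m

theorem computable_greedyState {γ : Type*} [Primcodable γ] {J : γ → ℕ → ℚ × ℚ} {k : γ → ℕ}
    (hJ : Computable₂ J) (hb : Computable b) (hk : Computable k) :
    Computable fun c => greedyState (J c) b (k c) := by
  have hs : Computable fun p : γ × (ℕ × (ℚ × ℚ)) => p.2.1 :=
    Computable.fst.comp Computable.snd
  have hst : Computable fun p : γ × (ℕ × (ℚ × ℚ)) => p.2.2 :=
    Computable.snd.comp Computable.snd
  have hJ' : Computable₂ fun p : γ × (ℕ × (ℚ × ℚ)) => J p.1 :=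
    hJ.comp (Computable.fst.comp Computable.fst) Computable.snd
  have hQ : Computable fun p : γ × (ℕ × (ℚ × ℚ)) => coverReach (J p.1) (b p.2.1) p.2.1 :=
    computable_coverReach hJ' (hb.comp hs) hs
  have hstep : Computable₂ fun (c : γ) (r : ℕ × (ℚ × ℚ)) =>
      if r.2.1 ≤ b r.1 then
        (coverReach (J c) (b r.1) r.1, r.2.2 + (coverReach (J c) (b r.1) r.1 - b r.1))
      else r.2 :=
    Computable.ite ((Computable.fst.comp hst).rat_le (hb.comp hs))
      (hQ.pair ((Computable.snd.comp hst).rat_add (hQ.rat_sub (hb.comp hs)))) hst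
  refine (Computable.nat_rec hk (Computable.const (b 0, 0)) hstep).of_eq fun c => ?_
  induction k c with
  | zero => rfl
  | succ s ih =>
    simp only at ih ⊢
    rw [greedyState, ih]

theorem greedyState_snd_mono : Monotone fun m => (greedyState J b m).2 := by
  refine monotone_nat_of_le_succ fun m => ?_
  rw [greedyState]
  split_ifs
  · have := le_coverReach (J := J) (x := b m) m
    simp only
    linarith
  · exact le_rfl

theorem ofReal_greedyState_snd_le (m : ℕ) :
    ENNReal.ofReal (greedyState J b m).2 ≤
      volume ((⋃ i, Set.Ioo ((J i).1 : ℝ) ((J i).2 : ℝ)) ∩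
        Set.Iio ((greedyState J b m).1 : ℝ)) := by
  induction m with
  | zero => simp [greedyState]
  | succ m ih =>
    rw [greedyState]
    split_ifs with h
    · set U := ⋃ i, Set.Ioo ((J i).1 : ℝ) ((J i).2 : ℝ)
      set R := (greedyState J b m).1
      have hT : (0 : ℝ) ≤ (greedyState J b m).2 := by
        exact_mod_cast greedyState_snd_mono (J := J) (b := b) m.zero_le
      have hQ : (b m : ℝ) ≤ coverReach J (b m) m := by exact_mod_cast le_coverReach m
      have hRb : (R : ℝ) ≤ b m := by exact_mod_cast h
      have hdisj : Disjoint (U ∩ Set.Iio (R : ℝ)) (Set.Ico (b m : ℝ) (coverReach J (b m) m)) :=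
        Set.disjoint_left.2 fun y hy hy' => absurd hy.2 (not_lt.2 (hRb.trans hy'.1))
      have hsub : (U ∩ Set.Iio (R : ℝ)) ∪ Set.Ico (b m : ℝ) (coverReach J (b m) m) ⊆
          U ∩ Set.Iio ((coverReach J (b m) m : ℚ) : ℝ) :=
        Set.union_subset (fun y hy => ⟨hy.1, lt_of_lt_of_le hy.2 (hRb.trans hQ)⟩)
          fun y hy => ⟨Ico_coverReach_subset m hy, hy.2⟩
      refine le_trans ?_ (measure_mono hsub)
      rw [measure_union hdisj measurableSet_Ico, Real.volume_Ico]
      push_cast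
      rw [ENNReal.ofReal_add hT (sub_nonneg.2 hQ)]
      gcongr
    · exact ih

/-- If the intervals of `J` cover the limit of `b`, then at some stage the greedy covering gains at
least the distance between `b` and its limit. -/
theorem exists_sub_le_greedyState_sub {β : ℝ} (hbt : Tendsto (fun m => (b m : ℝ)) atTop (𝓝 β))
    (hbβ : ∀ m, (b m : ℝ) < β) (hβ : β ∈ ⋃ i, Set.Ioo ((J i).1 : ℝ) ((J i).2 : ℝ)) :
    ∃ m, β - b m ≤ (greedyState J b (m + 1)).2 - (greedyState J b m).2 := by
  by_contra! hno
  have hjump : ∀ m, (greedyState J b m).1 ≤ b m → (coverReach J (b m) m : ℝ) < β := by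
    intro m hm
    have := hno m
    rw [greedyState, if_pos hm] at this
    push_cast at this
    linarith
  have hR : ∀ m, ((greedyState J b m).1 : ℝ) < β := by
    intro m
    induction m with
    | zero => exact hbβ 0
    | succ m ih =>
      rw [greedyState]
      split_ifs with h
      · exact hjump m h
      · exact ih
  obtain ⟨i, hi1, hi2⟩ := Set.mem_iUnion.1 hβ
  obtain ⟨m₀, hm₀⟩ := eventually_atTop.1 (hbt.eventually (lt_mem_nhds hi1))
  obtain ⟨m, hm, hle⟩ := exists_ge_le_of_tendsto (R := fun m => (greedyState J b m).1) hbt hR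
    (fun m h => by rw [greedyState, if_neg (not_le.2 h)]) (max m₀ (i + 1))
  have h1 : (J i).1 < b m := by exact_mod_cast hm₀ m ((le_max_left _ _).trans hm)
  have h2 : ((J i).2 : ℝ) ≤ coverReach J (b m) m := by
    exact_mod_cast le_coverReach_of_lt ((le_max_right _ _).trans hm) h1
  exact absurd (hjump m hle) (not_lt.2 (hi2.le.trans h2))

end GreedyCover

section MatchedApproximation

open Filter
open scoped Topology

/-- The largest index reached at stage `m` by advancing one step at a time as long as `a` has
caught up with `r`. -/
def matchIndex (r a : ℕ → ℚ) : ℕ → ℕ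
  | 0 => 0
  | m + 1 => if r (matchIndex r a m + 1) ≤ a (m + 1) then matchIndex r a m + 1 else matchIndex r a m

theorem computable_matchIndex {r a : ℕ → ℚ} (hr : Computable r) (ha : Computable a) :
    Computable (matchIndex r a) := by
  have hs : Computable fun p : ℕ × (ℕ × ℕ) => p.2.1 + 1 :=
    Computable.succ.comp (Computable.fst.comp Computable.snd)
  have hi : Computable fun p : ℕ × (ℕ × ℕ) => p.2.2 := Computable.snd.comp Computable.snd
  have hi' : Computable fun p : ℕ × (ℕ × ℕ) => p.2.2 + 1 := Computable.succ.comp hi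
  have hstep : Computable₂ fun (_ : ℕ) (p : ℕ × ℕ) =>
      if r (p.2 + 1) ≤ a (p.1 + 1) then p.2 + 1 else p.2 :=
    Computable.ite ((hr.comp hi').rat_le (ha.comp hs)) hi' hi
  refine (Computable.nat_rec Computable.id (Computable.const 0) hstep).of_eq fun m => ?_
  simp only [id]
  induction m with
  | zero => rfl
  | succ s ih =>
    simp only at ih ⊢
    rw [matchIndex, ih]

variable {r a b : ℕ → ℚ} {α β : ℝ}

theorem matchIndex_mono : Monotone (matchIndex r a) := by
  refine monotone_nat_of_le_succ fun m => ?_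
  rw [matchIndex]
  split_ifs
  · exact Nat.le_succ _
  · exact le_rfl

theorem apply_matchIndex_le (ha : Monotone a) (h0 : r 0 ≤ a 0) (m : ℕ) :
    r (matchIndex r a m) ≤ a m := by
  induction m with
  | zero => exact h0
  | succ m ih =>
    rw [matchIndex]
    split_ifs with h
    · exact h
    · exact ih.trans (ha m.le_succ)

theorem tendsto_matchIndex (hat : Tendsto (fun n => (a n : ℝ)) atTop (𝓝 α))
    (hr : ∀ s, (r s : ℝ) < α) : Tendsto (matchIndex r a) atTop atTop := by
  refine tendsto_atTop_atTop_of_monotone matchIndex_mono fun N => ?_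
  induction N with
  | zero => exact ⟨0, Nat.zero_le _⟩
  | succ N ih =>
    obtain ⟨m, hm⟩ := ih
    obtain ⟨k, hk⟩ := eventually_atTop.1 (hat.eventually (lt_mem_nhds (hr (N + 1))))
    refine ⟨max m k + 1, ?_⟩
    have h1 : N ≤ matchIndex r a (max m k) := hm.trans (matchIndex_mono (le_max_left _ _))
    rcases h1.eq_or_lt with h1 | h1
    · have h2 : r (N + 1) ≤ a (max m k + 1) := by
        exact_mod_cast (hk (max m k + 1) ((le_max_right _ _).trans (Nat.le_succ _))).le
      rw [matchIndex, ← h1, if_pos h2]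
    · exact Nat.succ_le_of_lt (h1.trans_le (matchIndex_mono (Nat.le_succ _)))

/-- The sequence `x, u 0, u 1, …`. -/
def prependTerm (x : ℚ) (u : ℕ → ℚ) : ℕ → ℚ
  | 0 => x
  | n + 1 => u n

theorem computable_prependTerm (x : ℚ) {u : ℕ → ℚ} (hu : Computable u) :
    Computable (prependTerm x u) :=
  (Computable.nat_casesOn (h := fun _ n => u n) Computable.id (Computable.const x)
    (hu.comp Computable.snd).to₂).of_eq fun n => by cases n <;> rfl

/-- Solovay reducibility allows to synchronize an approximation of `β` with a given approximation
of `α`. -/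
theorem SolovayRed.exists_matched_approx (h : SolovayRed α β) (hβ : LeftCE β)
    (ha : LeftCEApprox a α) :
    ∃ c : ℚ, ∃ b : ℕ → ℚ, LeftCEApprox b β ∧ (∀ m, (b m : ℝ) < β) ∧
      ∀ m, α - a m ≤ c * (β - b m) := by
  obtain ⟨c, f, hf, hfq⟩ := h
  obtain ⟨b, ⟨hbc, hbm, hbt⟩, hbβ⟩ := hβ.exists_strict_approx
  obtain ⟨hac, ham, hat⟩ := ha
  choose r hrf hrα hrc using fun s => hfq (b s) (hbβ s)
  have hr : Computable r := (hf.comp hbc).of_eq_tot hrf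
  have hc : (0 : ℝ) < c :=
    pos_of_mul_pos_left ((sub_pos.2 (hrα 0)).trans (hrc 0)) (sub_pos.2 (hbβ 0)).le
  obtain ⟨q, hq⟩ := exists_rat_lt (β - (α - a 0) / c)
  let r' := prependTerm (a 0) r
  let b' := prependTerm (min (b 0) q) b
  have hr'0 : r' 0 ≤ a 0 := le_rfl
  have hr'c : Computable r' := computable_prependTerm _ hr
  have hb'c : Computable b' := computable_prependTerm _ hbc
  have hb'm : Monotone b' := monotone_nat_of_le_succ fun n => by
    cases n with
    | zero => exact min_le_left _ _
    | succ n => exact hbm n.le_succ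
  have hb't : Tendsto (fun n => (b' n : ℝ)) atTop (𝓝 β) := (tendsto_add_atTop_iff_nat 1).1 hbt
  have hb'β : ∀ n, (b' n : ℝ) < β := fun n => by
    cases n with
    | zero => exact lt_of_le_of_lt (by exact_mod_cast min_le_left _ _) (hbβ 0)
    | succ n => exact hbβ n
  have hgap : ∀ n, α - r' n ≤ c * (β - b' n) := fun n => by
    cases n with
    | zero =>
      have h1 : (b' 0 : ℝ) ≤ q := by exact_mod_cast min_le_right _ _
      change α - a 0 ≤ c * (β - b' 0)
      rw [← div_le_iff₀' hc]
      linarith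
    | succ n => exact (hrc n).le
  by_cases ha0 : (a 0 : ℝ) < α
  · have hr'α : ∀ n, (r' n : ℝ) < α := fun n => by
      cases n with
      | zero => exact ha0
      | succ n => exact hrα n
    refine ⟨c, fun m => b' (matchIndex r' a m), ⟨hb'c.comp (computable_matchIndex hr'c hac),
      hb'm.comp matchIndex_mono, hb't.comp (tendsto_matchIndex hat hr'α)⟩,
      fun m => hb'β _, fun m => ?_⟩
    have h1 : (r' (matchIndex r' a m) : ℝ) ≤ a m := by
      exact_mod_cast apply_matchIndex_le ham hr'0 m
    linarith [hgap (matchIndex r' a m)]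
  · refine ⟨c, b, ⟨hbc, hbm, hbt⟩, hbβ, fun m => ?_⟩
    have h1 : (a 0 : ℝ) ≤ a m := by exact_mod_cast ham m.zero_le
    have h2 := mul_pos hc (sub_pos.2 (hbβ m))
    linarith

end MatchedApproximation

section UniversalSum

open Filter MeasureTheory Nat.Partrec
open scoped Topology ENNReal

theorem Computable.rat_sum_range {γ : Type*} [Primcodable γ] {g : γ → ℕ → ℚ} {k : γ → ℕ}
    (hg : Computable₂ g) (hk : Computable k) :
    Computable fun c => ∑ i ∈ Finset.range (k c), g c i := by
  have hstep : Computable₂ fun (c : γ) (p : ℕ × ℚ) => p.2 + g c p.1 :=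
    (Computable.snd.comp Computable.snd).rat_add
      (hg.comp Computable.fst (Computable.fst.comp Computable.snd))
  refine (Computable.nat_rec hk (Computable.const 0) hstep).of_eq fun c => ?_
  induction k c with
  | zero => rfl
  | succ s ih => rw [Finset.sum_range_succ, ← ih]

/-- The rational output by the `e`-th program on input `(e, j)` within `t` steps, where
`i = (j, t)`, or `0` if there is none. -/
def programValue (e i : ℕ) : ℚ :=
  ((Code.evaln i.unpair.2 (Denumerable.ofNat Code e) (Nat.pair e i.unpair.1)).map
    (Denumerable.ofNat ℚ)).getD 0

theorem computable_programValue : Computable₂ programValue := by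
  have h1 : Primrec fun p : ℕ × ℕ =>
      Code.evaln p.2.unpair.2 (Denumerable.ofNat Code p.1) (Nat.pair p.1 p.2.unpair.1) := by
    have hu := Primrec.unpair.comp (Primrec.snd (α := ℕ) (β := ℕ))
    exact Code.primrec_evaln.comp ((((Primrec.snd.comp hu).pair
      ((Primrec.ofNat Code).comp Primrec.fst))).pair
        (Primrec₂.natPair.comp Primrec.fst (Primrec.fst.comp hu)))
  exact (Primrec.option_getD.comp (Primrec.option_map h1 ((Primrec.ofNat ℚ).comp Primrec.snd).to₂)
    (Primrec.const 0)).to_comp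

/-- The largest of the first `s` values of the `e`-th program, truncated to `[0, 1]`. -/
def programMax (e : ℕ) : ℕ → ℚ
  | 0 => 0
  | s + 1 => max (programMax e s) (min 1 (programValue e s))

theorem computable_programMax : Computable₂ programMax := by
  have hstep : Computable₂ fun (c : ℕ × ℕ) (p : ℕ × ℚ) => max p.2 (min 1 (programValue c.1 p.1)) :=
    (Computable.snd.comp Computable.snd).rat_max ((Computable.const 1).rat_min
      (computable_programValue.comp (Computable.fst.comp Computable.fst)
        (Computable.fst.comp Computable.snd)))
  refine (Computable.nat_rec Computable.snd (Computable.const 0) hstep).of_eq fun c => ?_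
  obtain ⟨e, s⟩ := c
  induction s with
  | zero => rfl
  | succ s ih =>
    simp only at ih ⊢
    rw [programMax, ih]

theorem programMax_mono (e : ℕ) : Monotone (programMax e) :=
  monotone_nat_of_le_succ fun _ => le_max_left _ _

theorem programMax_nonneg (e s : ℕ) : 0 ≤ programMax e s :=
  programMax_mono e s.zero_le

theorem programMax_le_one (e s : ℕ) : programMax e s ≤ 1 := by
  induction s with
  | zero => exact zero_le_one
  | succ s ih => exact max_le ih (min_le_left _ _)

theorem exists_programMax {g : ℕ → ℕ → ℚ} (hg : Computable₂ g) (hmono : ∀ e, Monotone (g e))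
    (h0 : ∀ e s, 0 ≤ g e s) (h1 : ∀ e s, g e s ≤ 1) :
    ∃ e, (∀ s, programMax e s ≤ g e s) ∧ ∀ s, ∃ t, g e s ≤ programMax e t := by
  have hG : Nat.Partrec fun n => Part.some
      (@Encodable.encode ℚ Rat.instDenumerable.toEncodable (g n.unpair.1 n.unpair.2)) := by
    have : Computable fun n : ℕ =>
        @Encodable.encode ℚ Rat.instDenumerable.toEncodable (g n.unpair.1 n.unpair.2) :=
      Computable.encode.comp (hg.comp (Primrec.fst.comp Primrec.unpair).to_comp
        (Primrec.snd.comp Primrec.unpair).to_comp)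
    exact Partrec.nat_iff.1 this
  obtain ⟨code, hcode⟩ := Code.exists_code.1 hG
  have hval : ∀ i x : ℕ,
      x ∈ Code.evaln i.unpair.2 code (Nat.pair (Encodable.encode code) i.unpair.1) →
      Denumerable.ofNat ℚ x = g (Encodable.encode code) i.unpair.1 := by
    intro i x hx
    have := Code.evaln_sound hx
    rw [hcode] at this
    simp only [Nat.unpair_pair, Part.mem_some_iff] at this
    rw [this, Denumerable.ofNat_encode]
  refine ⟨Encodable.encode code, fun s => ?_, fun s => ?_⟩
  · induction s with
    | zero => exact h0 _ _
    | succ s ih =>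
      refine max_le (ih.trans (hmono _ s.le_succ)) ((min_le_right _ _).trans ?_)
      rw [programValue, Denumerable.ofNat_encode]
      rcases hx : Code.evaln s.unpair.2 code (Nat.pair (Encodable.encode code) s.unpair.1)
        with _ | x
      · exact h0 _ _
      · rw [Option.map_some, Option.getD_some, hval s x hx]
        exact hmono _ ((Nat.unpair_left_le s).trans s.le_succ)
  · obtain ⟨k, hk⟩ := Code.evaln_complete.1 (show
      @Encodable.encode ℚ Rat.instDenumerable.toEncodable (g (Encodable.encode code) s) ∈
        code.eval (Nat.pair (Encodable.encode code) s) by rw [hcode]; simp)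
    refine ⟨Nat.pair s k + 1, le_max_of_le_right (le_min (h1 _ _) (le_of_eq ?_))⟩
    rw [programValue, Denumerable.ofNat_encode, Nat.unpair_pair]
    simp only
    rw [Option.mem_def.1 hk, Option.map_some, Option.getD_some, Denumerable.ofNat_encode]

/-- A weighted sum of all program maxima. -/
def universalApprox (s : ℕ) : ℚ :=
  1 / 4 + ∑ e ∈ Finset.range s, (1 / 2) ^ (e + 2) * programMax e s

theorem computable_universalApprox : Computable universalApprox := by
  refine (Computable.const (1 / 4)).rat_add (Computable.rat_sum_range ?_ Computable.id)
  exact (Computable.rat_pow _ (Computable.nat_add' Computable.snd (Computable.const 2))).rat_mul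
    (computable_programMax.comp Computable.snd Computable.fst)

theorem universalApprox_add_le {m M : ℕ} (hmM : m ≤ M) {e : ℕ} (he : e < M) :
    universalApprox m + (1 / 2) ^ (e + 2) * (programMax e M - programMax e m) ≤
      universalApprox M := by
  have h1 : ∑ e ∈ Finset.range m, (1 / 2 : ℚ) ^ (e + 2) * programMax e m ≤
      ∑ e ∈ Finset.range M, (1 / 2 : ℚ) ^ (e + 2) * programMax e m :=
    Finset.sum_le_sum_of_subset_of_nonneg (Finset.range_mono hmM) fun i _ _ =>
      mul_nonneg (by positivity) (programMax_nonneg i m)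
  have h2 : (1 / 2 : ℚ) ^ (e + 2) * (programMax e M - programMax e m) ≤
      ∑ e ∈ Finset.range M, (1 / 2 : ℚ) ^ (e + 2) * (programMax e M - programMax e m) :=
    Finset.single_le_sum (f := fun e => (1 / 2 : ℚ) ^ (e + 2) * (programMax e M - programMax e m))
      (fun i _ => mul_nonneg (by positivity) (sub_nonneg.2 (programMax_mono i hmM)))
      (Finset.mem_range.2 he)
  simp only [mul_sub, Finset.sum_sub_distrib] at h2 ⊢
  unfold universalApprox
  linarith

theorem universalApprox_mono : Monotone universalApprox := by
  refine monotone_nat_of_le_succ fun m => ?_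
  have := universalApprox_add_le m.le_succ m.lt_succ_self
  have h2 : (0 : ℚ) ≤ (1 / 2) ^ (m + 2) * (programMax m (m + 1) - programMax m m) :=
    mul_nonneg (by positivity) (sub_nonneg.2 (programMax_mono m m.le_succ))
  exact (le_add_of_nonneg_right h2).trans this

theorem universalApprox_le (s : ℕ) : universalApprox s ≤ 3 / 4 := by
  have h1 : ∀ n : ℕ, ∑ e ∈ Finset.range n, (1 / 2 : ℚ) ^ (e + 2) = 1 / 2 - (1 / 2) ^ (n + 1) := by
    intro n
    induction n with
    | zero => norm_num
    | succ n ih => rw [Finset.sum_range_succ, ih]; ring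
  have h2 : ∑ e ∈ Finset.range s, (1 / 2 : ℚ) ^ (e + 2) * programMax e s ≤
      ∑ e ∈ Finset.range s, (1 / 2 : ℚ) ^ (e + 2) :=
    Finset.sum_le_sum fun e _ => mul_le_of_le_one_right (by positivity) (programMax_le_one e s)
  have h3 : (0 : ℚ) < (1 / 2) ^ (s + 1) := by positivity
  rw [h1] at h2
  unfold universalApprox
  linarith

/-- There is an approximation of a real in `(0, 1)` converging at least as slowly, up to a constant,
as some member of any given computable sequence of bounded monotone approximations. -/
theorem exists_universal_approx : ∃ α ∈ Set.Ioo (0 : ℝ) 1, ∃ a : ℕ → ℚ, LeftCEApprox a α ∧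
    ∀ g : ℕ → ℕ → ℚ, Computable₂ g → (∀ e, Monotone (g e)) → (∀ e s, 0 ≤ g e s) →
      (∀ e s, g e s ≤ 1) →
      ∃ e, ∀ m, ((1 / 2) ^ (e + 2) * (g e (m + 1) - g e m) : ℝ) ≤ α - a m := by
  have hmono : Monotone fun s => (universalApprox s : ℝ) := Rat.cast_mono.comp universalApprox_mono
  have hle : ∀ s, (universalApprox s : ℝ) ≤ 3 / 4 := fun s => by
    have := (Rat.cast_le (K := ℝ)).2 (universalApprox_le s)
    push_cast at this
    exact this
  have hbdd : BddAbove (Set.range fun s => (universalApprox s : ℝ)) :=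
    ⟨3 / 4, Set.forall_mem_range.2 hle⟩
  have hα : ∀ s, (universalApprox s : ℝ) ≤ ⨆ s, (universalApprox s : ℝ) := le_ciSup hbdd
  refine ⟨⨆ s, (universalApprox s : ℝ), ⟨?_, ?_⟩, universalApprox,
    ⟨computable_universalApprox, universalApprox_mono, tendsto_atTop_ciSup hmono hbdd⟩, ?_⟩
  · have := hα 0
    have h0 : (universalApprox 0 : ℝ) = 1 / 4 := by simp [universalApprox]
    linarith
  · have := ciSup_le hle
    linarith
  · intro g hg hgm h0 h1
    obtain ⟨e, he1, he2⟩ := exists_programMax hg hgm h0 h1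
    refine ⟨e, fun m => ?_⟩
    obtain ⟨t, ht⟩ := he2 (m + 1)
    have hM : universalApprox m + (1 / 2) ^ (e + 2) * (g e (m + 1) - g e m) ≤
        universalApprox (max t (max m (e + 1))) := by
      refine le_trans ?_ (universalApprox_add_le (M := max t (max m (e + 1)))
        ((le_max_left _ _).trans (le_max_right _ _))
        ((le_max_right m (e + 1)).trans (le_max_right _ _)))
      gcongr
      · exact ht.trans (programMax_mono e (le_max_left _ _))
      · exact he1 m
    have hM' : ((universalApprox m + (1 / 2) ^ (e + 2) * (g e (m + 1) - g e m) : ℚ) : ℝ) ≤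
        universalApprox (max t (max m (e + 1))) := by exact_mod_cast hM
    push_cast at hM'
    linarith [hα (max t (max m (e + 1)))]

theorem mlRandom_of_forall_solovayRed {β : ℝ} (hβ : LeftCE β)
    (h : ∀ α ∈ Set.Ioo (0 : ℝ) 1, LeftCE α → SolovayRed α β) : MLRandom β := by
  intro I hI hvol hmem
  obtain ⟨α, hα, a, ha, huniv⟩ := exists_universal_approx
  obtain ⟨c, b, ⟨hbc, -, hbt⟩, hbβ, hgap⟩ := (h α hα ⟨a, ha⟩).exists_matched_approx hβ ha
  obtain ⟨d, hd⟩ := pow_unbounded_of_one_lt (c : ℝ) (one_lt_two (α := ℝ))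
  obtain ⟨e, he⟩ := huniv (fun e m => 2 ^ (e + 2 + d) * (greedyState (I (e + 2 + d)) b m).2)
    (by
      have hl : Computable fun p : ℕ × ℕ => p.1 + 2 + d :=
        Computable.nat_add' (Computable.nat_add' Computable.fst (Computable.const 2))
          (Computable.const d)
      have hI' : Computable₂ fun (p : ℕ × ℕ) => I (p.1 + 2 + d) :=
        hI.comp (hl.comp Computable.fst) Computable.snd
      exact (Computable.rat_pow 2 hl).rat_mul
        (Computable.snd.comp (computable_greedyState hI' hbc Computable.snd)))
    (fun e => greedyState_snd_mono.const_mul (by positivity))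
    (fun e m => mul_nonneg (by positivity) (greedyState_snd_mono m.zero_le))
    (fun e m => by
      have h1 := (ofReal_greedyState_snd_le (J := I (e + 2 + d)) (b := b) m).trans
        ((measure_mono Set.inter_subset_left).trans (hvol (e + 2 + d)))
      rw [two_zpow_neg_eq_ofReal, ENNReal.ofReal_le_ofReal_iff (by positivity)] at h1
      have h2 : (greedyState (I (e + 2 + d)) b m).2 ≤ (1 / 2) ^ (e + 2 + d) := by
        exact_mod_cast (Rat.cast_le (K := ℝ)).1 (by push_cast; exact h1)
      calc _ ≤ (2 : ℚ) ^ (e + 2 + d) * (1 / 2) ^ (e + 2 + d) := by gcongr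
        _ = 1 := by rw [← mul_pow]; norm_num)
  obtain ⟨m, hm⟩ := exists_sub_le_greedyState_sub hbt hbβ (Set.mem_iInter.1 hmem (e + 2 + d))
  have h1 := (he m).trans (hgap m)
  have h2 := sub_pos.2 (hbβ m)
  have h3 : (1 / 2 : ℝ) ^ (e + 2) * 2 ^ (e + 2 + d) = 2 ^ d := by
    rw [pow_add 2 (e + 2) d, ← mul_assoc, ← mul_pow]
    norm_num
  push_cast at h1
  rw [← mul_sub, ← mul_assoc, h3] at h1
  have h4 : (2 : ℝ) ^ d * (β - b m) ≤ c * (β - b m) := le_trans (by gcongr) h1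
  exact absurd (lt_of_mul_lt_mul_right (h4.trans_lt (mul_lt_mul_of_pos_right hd h2)) h2.le)
    (lt_irrefl _)

end UniversalSum

/-- A left-c.e. real β in (0,1) is Martin-Löf random iff α ≤_S β for
every left-c.e. real α in (0,1). -/
theorem stmt_6 (β : ℝ) (h1 : β ∈ Set.Ioo (0:ℝ) 1) (h2 : LeftCE β) :
    MLRandom β ↔ ∀ α : ℝ, α ∈ Set.Ioo (0:ℝ) 1 → LeftCE α → SolovayRed α β := by
  exact ⟨fun h _ _ hα => h.solovayRed hα h2, mlRandom_of_forall_solovayRed h2⟩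
end

section
/- If α and β are left-c.e. reals and α + β is Martin-Löf random, then α is Martin-Löf random or β is Martin-Löf random. -/
open scoped Classical

/-- The code of `q` in the undenumerated encoding of `ℚ` by numerators and denominators. -/
def ratCode (q : ℚ) : ℕ := @Encodable.encode ℚ Rat.instEncodable q

theorem ratCode_eq (q : ℚ) : ratCode q = Nat.pair (Encodable.encode q.num) q.den := rfl

theorem encode_rat_eq_count (q : ℚ) :
    @Encodable.encode ℚ Primcodable.toEncodable q =
      Nat.count (fun n => n ∈ Set.range ratCode) (ratCode q) := by
  have h : @Encodable.encode ℚ Primcodable.toEncodable q =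
      (List.range (ratCode q)).countP (fun n => @decide (n ∈ Set.range ratCode)
        (@Encodable.decidableRangeEncode _ Rat.instEncodable n)) := rfl
  rw [h, Nat.count]
  congr 1
  funext n
  exact decide_eq_decide.2 Iff.rfl

theorem mem_range_ratCode (n : ℕ) : n ∈ Set.range ratCode ↔
    n.unpair.2 ≠ 0 ∧ ((n.unpair.1 + 1) / 2).Coprime n.unpair.2 := by
  constructor
  · rintro ⟨q, rfl⟩
    rw [ratCode_eq, Nat.unpair_pair]
    refine ⟨q.den_nz, ?_⟩
    have h := q.reduced
    obtain ⟨num, den, hd, hr⟩ := q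
    cases num with
    | ofNat m =>
      change ((2 * m + 1) / 2).Coprime den
      have : (2 * m + 1) / 2 = m := by omega
      rw [this]; exact hr
    | negSucc m =>
      change ((2 * m + 1 + 1) / 2).Coprime den
      have : (2 * m + 1 + 1) / 2 = m + 1 := by omega
      rw [this]; exact hr
  · rintro ⟨h0, hc⟩
    rcases Nat.even_or_odd' n.unpair.1 with ⟨m, hm | hm⟩
    · refine ⟨⟨Int.ofNat m, n.unpair.2, h0, ?_⟩, ?_⟩
      · have : (n.unpair.1 + 1) / 2 = m := by omega
        rw [this] at hc; exact hc
      · rw [ratCode_eq]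
        change Nat.pair (2 * m) n.unpair.2 = n
        rw [← hm, Nat.pair_unpair]
    · refine ⟨⟨Int.negSucc m, n.unpair.2, h0, ?_⟩, ?_⟩
      · have : (n.unpair.1 + 1) / 2 = m + 1 := by omega
        rw [this] at hc; exact hc
      · rw [ratCode_eq]
        change Nat.pair (2 * m + 1) n.unpair.2 = n
        rw [← hm, Nat.pair_unpair]

theorem primrecRel_dvd : PrimrecRel (fun a b : ℕ => a ∣ b) := by
  refine PrimrecRel.of_eq (r := fun a b : ℕ => b % a = 0) ?_ fun a b => (Nat.dvd_iff_mod_eq_zero).symm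
  exact Primrec.eq.comp₂ (Primrec.nat_mod.comp₂ Primrec₂.right Primrec₂.left) (Primrec₂.const 0)

theorem primrecRel_coprime : PrimrecRel (fun a b : ℕ => Nat.Coprime a b) := by
  have hR : PrimrecRel fun d n : ℕ => ¬ (d ∣ n.unpair.1 ∧ d ∣ n.unpair.2) ∨ d = 1 := by
    refine PrimrecPred.or (PrimrecPred.not (PrimrecPred.and ?_ ?_)) ?_
    · exact primrecRel_dvd.comp Primrec.fst (Primrec.fst.comp (Primrec.unpair.comp Primrec.snd))
    · exact primrecRel_dvd.comp Primrec.fst (Primrec.snd.comp (Primrec.unpair.comp Primrec.snd))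
    · exact Primrec.eq.comp Primrec.fst (Primrec.const 1)
  have h := (PrimrecRel.forall_lt hR).comp (f := fun p : ℕ × ℕ => p.1 + p.2 + 1)
    (g := fun p => Nat.pair p.1 p.2)
    (Primrec.succ.comp (Primrec.nat_add.comp Primrec.fst Primrec.snd))
    (Primrec₂.natPair.comp Primrec.fst Primrec.snd)
  refine PrimrecPred.of_eq h fun p => ?_
  simp only [Nat.unpair_pair]
  constructor
  · intro H
    have := H (Nat.gcd p.1 p.2) (by
      rcases Nat.eq_zero_or_pos p.1 with h | h
      · simp [h]
      · have := Nat.gcd_le_left p.2 h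
        omega)
    rcases this with h | h
    · exact absurd ⟨Nat.gcd_dvd_left _ _, Nat.gcd_dvd_right _ _⟩ h
    · exact h
  · intro H d _
    by_cases hd : d ∣ p.1 ∧ d ∣ p.2
    · exact Or.inr (Nat.eq_one_of_dvd_coprimes H hd.1 hd.2)
    · exact Or.inl hd

theorem primrecPred_mem_range_ratCode : PrimrecPred (fun n => n ∈ Set.range ratCode) := by
  refine PrimrecPred.of_eq (PrimrecPred.and (PrimrecPred.not ?_) ?_)
    fun n => (mem_range_ratCode n).symm
  · exact Primrec.eq.comp (Primrec.snd.comp Primrec.unpair) (Primrec.const 0)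
  · exact primrecRel_coprime.comp (Primrec.nat_div.comp
      (Primrec.succ.comp (Primrec.fst.comp Primrec.unpair)) (Primrec.const 2))
      (Primrec.snd.comp Primrec.unpair)

theorem Primrec.nat_count {p : ℕ → Prop} [DecidablePred p] (hp : PrimrecPred p) :
    Primrec (Nat.count p) := by
  refine (Primrec.nat_rec₁ (f := fun n c => if p n then c + 1 else c) 0 ?_).of_eq fun n => ?_
  · exact Primrec.ite (hp.comp Primrec.fst) (Primrec.succ.comp Primrec.snd) Primrec.snd
  · induction n with
    | zero => simp
    | succ n ih => rw [Nat.count_succ, ← ih]; by_cases h : p n <;> simp [h]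

theorem computable_ratCode : Computable ratCode := by
  have hP : ComputablePred fun x : ℚ × ℕ => x.2 ∈ Set.range ratCode ∧
      Nat.count (fun n => n ∈ Set.range ratCode) x.2 =
        @Encodable.encode ℚ Primcodable.toEncodable x.1 := by
    refine ⟨inferInstance, Primrec.to_comp (PrimrecPred.decide ?_)⟩
    refine PrimrecPred.and (primrecPred_mem_range_ratCode.comp Primrec.snd) (Primrec.eq.comp
      ((Primrec.nat_count primrecPred_mem_range_ratCode).comp Primrec.snd)
      (Primrec.encode.comp Primrec.fst))
  refine (Computable.find (P := fun (q : ℚ) n => n ∈ Set.range ratCode ∧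
      Nat.count (fun n => n ∈ Set.range ratCode) n =
        @Encodable.encode ℚ Primcodable.toEncodable q) hP
      fun q => ⟨ratCode q, ⟨q, rfl⟩, (encode_rat_eq_count q).symm⟩).of_eq fun q => ?_
  generalize_proofs h
  obtain ⟨h₁, h₂⟩ := Nat.find_spec h
  exact Nat.count_injective h₁ ⟨q, rfl⟩ (h₂.trans (encode_rat_eq_count q))

theorem Computable.nat_add_comp {γ : Type*} [Primcodable γ] {f g : γ → ℕ} (hf : Computable f)
    (hg : Computable g) : Computable fun a => f a + g a :=
  Primrec.nat_add.to_comp.comp hf hg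

theorem Computable.nat_mul_comp {γ : Type*} [Primcodable γ] {f g : γ → ℕ} (hf : Computable f)
    (hg : Computable g) : Computable fun a => f a * g a :=
  Primrec.nat_mul.to_comp.comp hf hg

/-- The positive part of the numerator. -/
def ratPos (q : ℚ) : ℕ := q.num.toNat

/-- The negative part of the numerator. -/
def ratNeg (q : ℚ) : ℕ := (-q.num).toNat

theorem computable_ratPos : Computable ratPos := by
  have hc : Computable fun q => (ratCode q).unpair.1 :=
    Computable.fst.comp (Computable.unpair.comp computable_ratCode)
  refine (((Primrec.nat_mul.comp (Primrec.nat_mod.comp Primrec.succ (Primrec.const 2))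
    (Primrec.nat_div.comp Primrec.id (Primrec.const 2))).to_comp).comp hc).of_eq fun q => ?_
  rw [ratCode_eq, Nat.unpair_pair, ratPos]
  cases q.num with
  | ofNat m =>
    change ((2 * m + 1) % 2) * (2 * m / 2) = m
    simp [Nat.add_mod]
  | negSucc m =>
    change ((2 * m + 1 + 1) % 2) * ((2 * m + 1) / 2) = 0
    simp [Nat.add_mod]

theorem computable_ratNeg : Computable ratNeg := by
  have hc : Computable fun q => (ratCode q).unpair.1 :=
    Computable.fst.comp (Computable.unpair.comp computable_ratCode)
  refine (((Primrec.nat_mul.comp (Primrec.nat_mod.comp Primrec.id (Primrec.const 2))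
    (Primrec.succ.comp (Primrec.nat_div.comp Primrec.id (Primrec.const 2)))).to_comp).comp
      hc).of_eq fun q => ?_
  rw [ratCode_eq, Nat.unpair_pair, ratNeg]
  cases q.num with
  | ofNat m =>
    change ((2 * m) % 2) * (2 * m / 2 + 1) = (-(m : ℤ)).toNat
    simp
  | negSucc m =>
    change ((2 * m + 1) % 2) * ((2 * m + 1) / 2 + 1) = m + 1
    have h₁ : (2 * m + 1) % 2 = 1 := by omega
    have h₂ : (2 * m + 1) / 2 = m := by omega
    rw [h₁, h₂, one_mul]

theorem computable_rat_den_s8 : Computable Rat.den :=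
  (Computable.snd.comp (Computable.unpair.comp computable_ratCode)).of_eq fun q => by
    rw [ratCode_eq, Nat.unpair_pair]

theorem rat_eq_ratPos_sub_ratNeg_div (q : ℚ) : q = ((ratPos q : ℚ) - ratNeg q) / q.den := by
  have h : ((ratPos q : ℤ) - ratNeg q) = q.num := by
    simp only [ratPos, ratNeg]; omega
  have h' : ((ratPos q : ℚ) - ratNeg q) = q.num := by exact_mod_cast h
  rw [h', Rat.num_div_den]

theorem rat_le_iff_ratPos_ratNeg (p q : ℚ) : p ≤ q ↔
    ratPos p * q.den + ratNeg q * p.den ≤ ratPos q * p.den + ratNeg p * q.den := by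
  have hp : (0 : ℚ) < p.den := by exact_mod_cast p.den_pos
  have hq : (0 : ℚ) < q.den := by exact_mod_cast q.den_pos
  conv_lhs => rw [rat_eq_ratPos_sub_ratNeg_div p, rat_eq_ratPos_sub_ratNeg_div q,
    div_le_div_iff₀ hp hq]
  rw [← Nat.cast_le (α := ℚ)]
  push_cast
  constructor <;> intro h <;> linarith

theorem rat_add_eq_iff_ratPos_ratNeg (p q r : ℚ) : p + q = r ↔
    ratPos p * q.den * r.den + ratPos q * p.den * r.den + ratNeg r * p.den * q.den =
      ratNeg p * q.den * r.den + ratNeg q * p.den * r.den + ratPos r * p.den * q.den := by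
  have hp : (p.den : ℚ) ≠ 0 := by exact_mod_cast p.den_nz
  have hq : (q.den : ℚ) ≠ 0 := by exact_mod_cast q.den_nz
  have hr : (r.den : ℚ) ≠ 0 := by exact_mod_cast r.den_nz
  conv_lhs => rw [rat_eq_ratPos_sub_ratNeg_div p, rat_eq_ratPos_sub_ratNeg_div q,
    rat_eq_ratPos_sub_ratNeg_div r, div_add_div _ _ hp hq, div_eq_div_iff (mul_ne_zero hp hq) hr]
  rw [← Nat.cast_inj (R := ℚ)]
  push_cast
  constructor <;> intro h <;> linarith

theorem PrimrecRel.computablePred_comp {γ δ ε : Type*} [Primcodable γ] [Primcodable δ]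
    [Primcodable ε] {R : δ → ε → Prop} (hR : PrimrecRel R) {f : γ → δ} {g : γ → ε}
    (hf : Computable f) (hg : Computable g) : ComputablePred fun a => R (f a) (g a) :=
  ⟨inferInstance, Computable₂.comp (Primrec₂.to_comp hR.decide) hf hg⟩

theorem Computable.of_rat_graph {γ : Type*} [Primcodable γ] {f : γ → ℚ}
    (h : ComputablePred fun p : γ × ℚ => f p.1 = p.2) : Computable f := by
  obtain ⟨_, hc⟩ := h
  have hg : Computable fun p : γ × ℕ => (p.1, Denumerable.ofNat ℚ p.2) :=
    Computable.pair Computable.fst ((Computable.ofNat ℚ).comp Computable.snd)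
  have hP : ComputablePred fun p : γ × ℕ => f p.1 = Denumerable.ofNat ℚ p.2 :=
    ⟨fun _ => inferInstance, (hc.comp hg).of_eq fun _ => decide_eq_decide.2 Iff.rfl⟩
  refine ((Computable.ofNat ℚ).comp (Computable.find
    (P := fun a n => f a = Denumerable.ofNat ℚ n) hP fun a =>
      ⟨@Encodable.encode ℚ Primcodable.toEncodable (f a), ?_⟩)).of_eq fun a => ?_
  · exact (Denumerable.ofNat_encode (f a)).symm
  · generalize_proofs h
    exact (Nat.find_spec h).symm

theorem computable_rat_le : Computable fun p : ℚ × ℚ => decide (p.1 ≤ p.2) := by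
  have h₁ : Computable fun p : ℚ × ℚ => p.1 := Computable.fst
  have h₂ : Computable fun p : ℚ × ℚ => p.2 := Computable.snd
  have h := PrimrecRel.computablePred_comp Primrec.nat_le
    (((computable_ratPos.comp h₁).nat_mul_comp (computable_rat_den_s8.comp h₂)).nat_add_comp
      ((computable_ratNeg.comp h₂).nat_mul_comp (computable_rat_den_s8.comp h₁)))
    (((computable_ratPos.comp h₂).nat_mul_comp (computable_rat_den_s8.comp h₁)).nat_add_comp
      ((computable_ratNeg.comp h₁).nat_mul_comp (computable_rat_den_s8.comp h₂)))
  exact h.decide.of_eq fun p => decide_eq_decide.2 (rat_le_iff_ratPos_ratNeg _ _).symm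

theorem computable_rat_add : Computable₂ fun p q : ℚ => p + q := by
  refine Computable.of_rat_graph ?_
  have h₁ : Computable fun p : (ℚ × ℚ) × ℚ => p.1.1 := Computable.fst.comp Computable.fst
  have h₂ : Computable fun p : (ℚ × ℚ) × ℚ => p.1.2 := Computable.snd.comp Computable.fst
  have h₃ : Computable fun p : (ℚ × ℚ) × ℚ => p.2 := Computable.snd
  have hd₁ := computable_rat_den_s8.comp h₁
  have hd₂ := computable_rat_den_s8.comp h₂
  have hd₃ := computable_rat_den_s8.comp h₃
  have h := PrimrecRel.computablePred_comp Primrec.eq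
    (((((computable_ratPos.comp h₁).nat_mul_comp hd₂).nat_mul_comp hd₃).nat_add_comp
      (((computable_ratPos.comp h₂).nat_mul_comp hd₁).nat_mul_comp hd₃)).nat_add_comp
      (((computable_ratNeg.comp h₃).nat_mul_comp hd₁).nat_mul_comp hd₂))
    (((((computable_ratNeg.comp h₁).nat_mul_comp hd₂).nat_mul_comp hd₃).nat_add_comp
      (((computable_ratNeg.comp h₂).nat_mul_comp hd₁).nat_mul_comp hd₃)).nat_add_comp
      (((computable_ratPos.comp h₃).nat_mul_comp hd₁).nat_mul_comp hd₂))
  exact h.of_eq fun p => (rat_add_eq_iff_ratPos_ratNeg _ _ _).symm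

theorem computable_rat_sub : Computable₂ fun p q : ℚ => p - q := by
  refine Computable.of_rat_graph ?_
  refine (PrimrecRel.computablePred_comp Primrec.eq (f := fun p : (ℚ × ℚ) × ℚ => p.2 + p.1.2)
    (g := fun p : (ℚ × ℚ) × ℚ => p.1.1) ?_ ?_).of_eq fun p => ?_
  · exact computable_rat_add.comp Computable.snd (Computable.snd.comp Computable.fst)
  · exact Computable.fst.comp Computable.fst
  · rw [sub_eq_iff_eq_add, eq_comm]

theorem computable_rat_min : Computable₂ fun p q : ℚ => min p q :=
  (Computable.cond computable_rat_le Computable.fst Computable.snd).of_eq fun p => by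
    by_cases h : p.1 ≤ p.2 <;> simp [h, le_of_not_ge]

theorem computable_inv_nat_succ : Computable fun n : ℕ => ((n : ℚ) + 1)⁻¹ := by
  refine Computable.of_rat_graph ?_
  have hn : Computable fun p : ℕ × ℚ => p.1 + 1 := Computable.succ.comp Computable.fst
  have hq : Computable fun p : ℕ × ℚ => p.2 := Computable.snd
  have h := PrimrecRel.computablePred_comp Primrec.eq
    ((computable_ratPos.comp hq).nat_mul_comp hn)
    ((computable_rat_den_s8.comp hq).nat_add_comp ((computable_ratNeg.comp hq).nat_mul_comp hn))
  refine h.of_eq fun p => ?_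
  have hn : ((p.1 : ℚ) + 1) ≠ 0 := by positivity
  have hd : (p.2.den : ℚ) ≠ 0 := by exact_mod_cast p.2.den_nz
  conv_rhs => rw [rat_eq_ratPos_sub_ratNeg_div p.2, inv_eq_one_div, div_eq_div_iff hn hd]
  rw [← Nat.cast_inj (R := ℚ)]
  push_cast
  constructor <;> intro h <;> linarith

open MeasureTheory in
theorem volume_le_add_of_monotone_of_add_eq_id {f g : ℝ → ℝ} (hf : Monotone f) (hg : Monotone g)
    (hfg : ∀ t, f t + g t = t) {W U V : Set ℝ} (hW : MeasurableSet W) (hU : f '' W ⊆ U)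
    (hV : g '' W ⊆ V) : volume W ≤ volume U + volume V := by
  have hdf := hf.ae_differentiableAt
  have hdg := hg.ae_differentiableAt
  let S := W ∩ {t | DifferentiableAt ℝ f t} ∩ {t | DifferentiableAt ℝ g t}
  have hS : MeasurableSet S :=
    (hW.inter (measurableSet_of_differentiableAt ℝ f)).inter (measurableSet_of_differentiableAt ℝ g)
  have hSW : S ⊆ W := fun t ht => ht.1.1
  have hWS : volume W ≤ volume S := by
    refine measure_mono_ae ?_
    filter_upwards [hdf, hdg] with t h₁ h₂ ht using ⟨⟨ht, h₁⟩, h₂⟩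
  have hF := lintegral_deriv_eq_volume_image_of_monotoneOn hS
    (fun t ht => ht.1.2.hasDerivAt.hasDerivWithinAt) (hf.monotoneOn S)
  have hG := lintegral_deriv_eq_volume_image_of_monotoneOn hS
    (fun t ht => ht.2.hasDerivAt.hasDerivWithinAt) (hg.monotoneOn S)
  have hsum : volume S = ∫⁻ t in S, ENNReal.ofReal (deriv f t) + ENNReal.ofReal (deriv g t) := by
    rw [← setLIntegral_one]
    refine setLIntegral_congr_fun hS fun t ht => ?_
    have h : HasDerivAt (fun t => f t + g t) (deriv f t + deriv g t) t :=
      ht.1.2.hasDerivAt.add ht.2.hasDerivAt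
    simp only [hfg] at h
    have h1 := h.unique (hasDerivAt_id' t)
    rw [← ENNReal.ofReal_add hf.deriv_nonneg hg.deriv_nonneg, h1, ENNReal.ofReal_one]
  rw [lintegral_add_left (measurable_deriv f).ennreal_ofReal, hF, hG] at hsum
  calc volume W ≤ volume S := hWS
    _ = _ := hsum
    _ ≤ _ := add_le_add (measure_mono ((Set.image_mono hSW).trans hU))
      (measure_mono ((Set.image_mono hSW).trans hV))

theorem exists_monotone_add_eq_id {x y : ℕ → ℝ} (hx : Monotone x) (hy : Monotone y) :
    ∃ f g : ℝ → ℝ, Monotone f ∧ Monotone g ∧ (∀ t, f t + g t = t) ∧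
      (∀ s, f (x s + y s) = x s) ∧ ∀ s, g (x s + y s) = y s := by
  have hle : ∀ s t, |(x s - y s) - (x t - y t)| ≤ |(x s + y s) - (x t + y t)| := by
    intro s t
    rcases le_total s t with h | h
    · have h₁ := hx h
      have h₂ := hy h
      rw [abs_of_nonpos (by linarith : (x s + y s) - (x t + y t) ≤ 0), abs_le]
      constructor <;> linarith
    · have h₁ := hx h
      have h₂ := hy h
      rw [abs_of_nonneg (by linarith : 0 ≤ (x s + y s) - (x t + y t)), abs_le]
      constructor <;> linarith
  let z : ℕ → ℝ := fun s => x s + y s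
  let k : ℝ → ℝ := fun t => if h : ∃ s, z s = t then x h.choose - y h.choose else 0
  have hk : ∀ s, k (z s) = x s - y s := by
    intro s
    have h : ∃ s', z s' = z s := ⟨s, rfl⟩
    have hd := hle h.choose s
    have hc : x h.choose + y h.choose = x s + y s := h.choose_spec
    rw [hc, sub_self, abs_zero] at hd
    simp only [k, dif_pos h]
    exact sub_eq_zero.1 (abs_nonpos_iff.1 hd)
  have hlip : LipschitzOnWith 1 k (Set.range z) := by
    refine LipschitzOnWith.of_dist_le_mul ?_
    rintro _ ⟨s, rfl⟩ _ ⟨t, rfl⟩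
    rw [hk, hk, Real.dist_eq, Real.dist_eq, NNReal.coe_one, one_mul]
    exact hle s t
  obtain ⟨h, hh, heq⟩ := hlip.extend_real
  have hz : ∀ s, h (x s + y s) = x s - y s := fun s => by
    rw [← hk s]; exact (heq ⟨s, rfl⟩).symm
  have habs : ∀ a b, a ≤ b → |h b - h a| ≤ b - a := fun a b hab => by
    have := hh.dist_le_mul b a
    rwa [Real.dist_eq, Real.dist_eq, NNReal.coe_one, one_mul,
      abs_of_nonneg (sub_nonneg.2 hab)] at this
  refine ⟨fun t => (t + h t) / 2, fun t => (t - h t) / 2, fun a b hab => ?_, fun a b hab => ?_,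
    fun t => by ring, fun s => ?_, fun s => ?_⟩
  · have := abs_le.1 (habs a b hab)
    simp only
    linarith [this.1]
  · have := abs_le.1 (habs a b hab)
    simp only
    linarith [this.2]
  · simp only [hz]; ring
  · simp only [hz]; ring

/-- The interval, of length at most `1`, that the sum of two increasing quantities sweeps out when it starts at `x + y`
and stops before the first one leaves `(a, b)` and the second one leaves `(c, d)`; it is empty
unless `a < x < b` and `c < y < d`. -/
def sweep (p : (ℚ × ℚ) × (ℚ × ℚ) × ℚ × ℚ) : ℚ × ℚ :=
  let r := min (min (p.2.1.2 - p.1.1) (p.2.2.2 - p.1.2))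
    (if p.2.1.1 < p.1.1 ∧ p.2.2.1 < p.1.2 then 1 else 0)
  (p.1.1 + p.1.2, p.1.1 + p.1.2 + r)

open MeasureTheory in
theorem volume_iUnion_sweep_le {ι : Type*} [Countable ι] {x y : ℕ → ℚ} (hx : Monotone x)
    (hy : Monotone y) (I J : ℕ → ℚ × ℚ) (e : ι → ℕ × ℕ × ℕ) :
    volume (⋃ m, Set.Ioo (((sweep ((x (e m).1, y (e m).1), I (e m).2.1, J (e m).2.2)).1 : ℚ) : ℝ)
      ((sweep ((x (e m).1, y (e m).1), I (e m).2.1, J (e m).2.2)).2 : ℚ)) ≤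
    volume (⋃ k, Set.Ioo ((I k).1 : ℝ) (I k).2) + volume (⋃ k, Set.Ioo ((J k).1 : ℝ) (J k).2) := by
  obtain ⟨f, g, hf, hg, hfg, hfx, hgy⟩ := exists_monotone_add_eq_id
    (x := fun s => (x s : ℝ)) (y := fun s => (y s : ℝ))
    (fun s t h => Rat.cast_le.2 (hx h)) (fun s t h => Rat.cast_le.2 (hy h))
  have key : ∀ t ∈ ⋃ m, Set.Ioo
      (((sweep ((x (e m).1, y (e m).1), I (e m).2.1, J (e m).2.2)).1 : ℚ) : ℝ)
      ((sweep ((x (e m).1, y (e m).1), I (e m).2.1, J (e m).2.2)).2 : ℚ),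
      f t ∈ (⋃ k, Set.Ioo ((I k).1 : ℝ) (I k).2) ∧ g t ∈ ⋃ k, Set.Ioo ((J k).1 : ℝ) (J k).2 := by
    intro t ht
    obtain ⟨m, ht⟩ := Set.mem_iUnion.1 ht
    generalize e m = p at ht
    obtain ⟨s, k, l⟩ := p
    simp only [sweep, Set.mem_Ioo] at ht
    obtain ⟨h₁, h₂⟩ := ht
    split_ifs at h₂ with hc
    · obtain ⟨hc₁, hc₂⟩ := hc
      push_cast at h₁ h₂
      have hc₁' : ((I k).1 : ℝ) < x s := Rat.cast_lt.2 hc₁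
      have hc₂' : ((J l).1 : ℝ) < y s := Rat.cast_lt.2 hc₂
      have hr : min (min (((I k).2 : ℝ) - x s) ((J l).2 - y s)) 1 ≤ (I k).2 - x s :=
        (min_le_left _ _).trans (min_le_left _ _)
      have hr' : min (min (((I k).2 : ℝ) - x s) ((J l).2 - y s)) 1 ≤ (J l).2 - y s :=
        (min_le_left _ _).trans (min_le_right _ _)
      have hf' := hf h₁.le
      have hg' := hg h₁.le
      have hs := hfg t
      rw [hfx] at hf'
      rw [hgy] at hg'
      exact ⟨Set.mem_iUnion.2 ⟨k, by linarith, by linarith⟩,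
        Set.mem_iUnion.2 ⟨l, by linarith, by linarith⟩⟩
    · push_cast at h₁ h₂
      have := min_le_right (min (((I k).2 : ℝ) - x s) ((J l).2 - y s)) 0
      linarith
  refine volume_le_add_of_monotone_of_add_eq_id hf hg hfg
    (MeasurableSet.iUnion fun m => measurableSet_Ioo) ?_ ?_
  · rintro _ ⟨t, ht, rfl⟩; exact (key t ht).1
  · rintro _ ⟨t, ht, rfl⟩; exact (key t ht).2

theorem exists_mem_Ioo_sweep {x y : ℕ → ℚ} {α β : ℝ} (hxα : ∀ s, (x s : ℝ) < α)
    (hyβ : ∀ s, (y s : ℝ) < β) (hx : Filter.Tendsto (fun s => (x s : ℝ)) Filter.atTop (nhds α))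
    (hy : Filter.Tendsto (fun s => (y s : ℝ)) Filter.atTop (nhds β)) {I J : ℚ × ℚ}
    (hI : α ∈ Set.Ioo (I.1 : ℝ) I.2) (hJ : β ∈ Set.Ioo (J.1 : ℝ) J.2) :
    ∃ s, α + β ∈ Set.Ioo (((sweep ((x s, y s), I, J)).1 : ℚ) : ℝ)
      ((sweep ((x s, y s), I, J)).2 : ℚ) := by
  let δ : ℝ := min (min (I.2 - α) (J.2 - β)) 1
  have hδ : 0 < δ := lt_min (lt_min (sub_pos.2 hI.2) (sub_pos.2 hJ.2)) one_pos
  obtain ⟨s, h₁, h₂, h₃⟩ := ((hx.eventually_const_lt hI.1).and ((hy.eventually_const_lt hJ.1).and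
    ((hx.add hy).eventually_const_lt (by linarith : α + β - δ < α + β)))).exists
  refine ⟨s, ?_⟩
  have hc : I.1 < x s ∧ J.1 < y s := ⟨by exact_mod_cast h₁, by exact_mod_cast h₂⟩
  have hα := hxα s
  have hβ := hyβ s
  have hr : δ ≤ min (min ((I.2 : ℝ) - x s) (J.2 - y s)) 1 :=
    min_le_min (min_le_min (by linarith) (by linarith)) le_rfl
  simp only [sweep, if_pos hc, Set.mem_Ioo]
  push_cast
  constructor <;> linarith

theorem computable_sweep : Computable sweep := by
  have hx : Computable fun p : (ℚ × ℚ) × (ℚ × ℚ) × ℚ × ℚ => p.1.1 :=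
    Computable.fst.comp Computable.fst
  have hy : Computable fun p : (ℚ × ℚ) × (ℚ × ℚ) × ℚ × ℚ => p.1.2 :=
    Computable.snd.comp Computable.fst
  have hI : Computable fun p : (ℚ × ℚ) × (ℚ × ℚ) × ℚ × ℚ => p.2.1 :=
    Computable.fst.comp Computable.snd
  have hJ : Computable fun p : (ℚ × ℚ) × (ℚ × ℚ) × ℚ × ℚ => p.2.2 :=
    Computable.snd.comp Computable.snd
  have hlt : Computable₂ fun a b : ℚ => decide (a < b) :=
    (Primrec.not.to_comp.comp (computable_rat_le.comp (Computable.snd.pair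
      Computable.fst))).of_eq fun p => by
      rw [← decide_not]; exact decide_eq_decide.2 not_le
  have hsum := computable_rat_add.comp hx hy
  have hc := Primrec.and.to_comp.comp (hlt.comp (Computable.fst.comp hI) hx)
    (hlt.comp (Computable.fst.comp hJ) hy)
  have hr := computable_rat_min.comp
    (computable_rat_min.comp (computable_rat_sub.comp (Computable.snd.comp hI) hx)
      (computable_rat_sub.comp (Computable.snd.comp hJ) hy))
    (Computable.cond hc (Computable.const (1 : ℚ)) (Computable.const 0))
  refine (Computable.pair hsum (computable_rat_add.comp hsum hr)).of_eq fun p => ?_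
  simp only [sweep, ← Bool.decide_and, Bool.cond_decide]

theorem LeftCE.exists_lt_approx {x : ℝ} (hx : LeftCE x) :
    ∃ q : ℕ → ℚ, LeftCEApprox q x ∧ ∀ s, (q s : ℝ) < x := by
  obtain ⟨q, hq, hmono, hlim⟩ := hx
  refine ⟨fun s => q s - ((s : ℚ) + 1)⁻¹, ⟨?_, ?_, ?_⟩, fun s => ?_⟩
  · exact computable_rat_sub.comp hq computable_inv_nat_succ
  · intro s t hst
    have : ((t : ℚ) + 1)⁻¹ ≤ ((s : ℚ) + 1)⁻¹ := by gcongr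
    exact sub_le_sub (hmono hst) this
  · have h := hlim.sub (tendsto_one_div_add_atTop_nhds_zero_nat (𝕜 := ℝ))
    simpa using h
  · have h : (q s : ℝ) ≤ x :=
      Monotone.ge_of_tendsto (fun a b hab => Rat.cast_le.2 (hmono hab)) hlim s
    have : (0 : ℝ) < ((s : ℝ) + 1)⁻¹ := by positivity
    push_cast
    linarith

/-- If α and β are left-c.e. reals and α + β is Martin-Löf random,
then α is Martin-Löf random or β is Martin-Löf random. -/
theorem stmt_8 (α β : ℝ) (hα : LeftCE α) (hβ : LeftCE β)
    (hrand : MLRandom (α + β)) : MLRandom α ∨ MLRandom β := by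
  by_contra! hnot
  obtain ⟨h₁, h₂⟩ := hnot
  simp only [MLRandom, not_forall, not_not] at h₁ h₂
  obtain ⟨I, hI, hIvol, hαI⟩ := h₁
  obtain ⟨J, hJ, hJvol, hβJ⟩ := h₂
  obtain ⟨x, ⟨hxc, hxm, hxl⟩, hxα⟩ := hα.exists_lt_approx
  obtain ⟨y, ⟨hyc, hym, hyl⟩, hyβ⟩ := hβ.exists_lt_approx
  let e : ℕ → ℕ × ℕ × ℕ := fun m => (m.unpair.1, m.unpair.2.unpair)
  refine hrand (fun n m => sweep ((x (e m).1, y (e m).1), I (n + 1) (e m).2.1,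
    J (n + 1) (e m).2.2)) ?_ (fun n => ?_) ?_
  · have hn : Computable fun p : ℕ × ℕ => p.1 + 1 := Computable.succ.comp Computable.fst
    have hu : Computable fun p : ℕ × ℕ => p.2.unpair := Computable.unpair.comp Computable.snd
    have hs : Computable fun p : ℕ × ℕ => p.2.unpair.1 := Computable.fst.comp hu
    have hv : Computable fun p : ℕ × ℕ => p.2.unpair.2.unpair :=
      Computable.unpair.comp (Computable.snd.comp hu)
    exact computable_sweep.comp (((hxc.comp hs).pair (hyc.comp hs)).pair
      ((hI.comp hn (Computable.fst.comp hv)).pair (hJ.comp hn (Computable.snd.comp hv))))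
  · refine (volume_iUnion_sweep_le hxm hym (I (n + 1)) (J (n + 1)) e).trans
      ((add_le_add (hIvol (n + 1)) (hJvol (n + 1))).trans_eq ?_)
    rw [← two_mul]
    nth_rw 1 [← zpow_one (2 : ENNReal)]
    rw [← ENNReal.zpow_add two_ne_zero ENNReal.ofNat_ne_top]
    congr 1
    push_cast
    ring
  · refine Set.mem_iInter.2 fun n => ?_
    obtain ⟨k, hk⟩ := Set.mem_iUnion.1 (Set.mem_iInter.1 hαI (n + 1))
    obtain ⟨l, hl⟩ := Set.mem_iUnion.1 (Set.mem_iInter.1 hβJ (n + 1))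
    obtain ⟨s, hs⟩ := exists_mem_Ioo_sweep hxα hyβ hxl hyl hk hl
    refine Set.mem_iUnion.2 ⟨Nat.pair s (Nat.pair k l), ?_⟩
    simpa only [e, Nat.unpair_pair] using hs
end
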